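/- Let μ ∈ Δ⁺_l and set w̃_μ = w_μ·s₀ ∈ Ŵ, where s₀ = s_{α₀} is the reflection in α₀ = δ − θ. Then: (1) w̃_μ(α₀) + δ = μ; (2) w̃_μ is minuscule; (3) every γ ∈ I_{w̃_μ} satisfies (γ, θ) > 0; (4) I_{w̃_μ} is contained in every element of Ab_μ (i.e., I_{w̃_μ} = I(μ)_min), and #(I_{w̃_μ}) = (ρ, θ∨ − μ∨) + 1. -/

import Mathlib

open scoped BigOperators

/-- Data of a reduced irreducible crystallographic root system `Δ`, spanning a
`ℚ`-vector space `V` equipped with a Weyl-group-invariant inner product `B`,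
together with a chosen system of positive roots `Pos` and the highest root `θ`. -/
structure RootSystemCtx (V : Type*) [AddCommGroup V] [Module ℚ V] where
  /-- the invariant inner product `( , )` -/
  B : V →ₗ[ℚ] V →ₗ[ℚ] ℚ
  B_symm : ∀ x y : V, B x y = B y x
  B_posdef : ∀ x : V, x ≠ 0 → 0 < B x x
  /-- the set of roots -/
  Δ : Set V
  Δ_finite : Δ.Finite
  Δ_spans : Submodule.span ℚ Δ = ⊤
  zero_notMem_Δ : (0 : V) ∉ Δ
  neg_mem_Δ : ∀ α ∈ Δ, -α ∈ Δ
  reduced : ∀ α ∈ Δ, ∀ c : ℚ, c • α ∈ Δ → c = 1 ∨ c = -1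
  crystallographic : ∀ α ∈ Δ, ∀ β ∈ Δ, ∃ n : ℤ, 2 * B α β / B β β = (n : ℚ)
  reflect_mem : ∀ α ∈ Δ, ∀ β ∈ Δ, β - (2 * B β α / B α α) • α ∈ Δ
  irreducible : ∀ S : Set V, S ⊆ Δ → (∀ α ∈ S, ∀ β ∈ Δ \ S, B α β = 0) → S = ∅ ∨ S = Δ
  /-- the positive roots `Δ⁺` -/
  Pos : Set V
  pos_subset : Pos ⊆ Δ
  mem_pos_or_neg_pos : ∀ α ∈ Δ, α ∈ Pos ∨ -α ∈ Pos
  pos_not_neg : ∀ α ∈ Pos, -α ∉ Pos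
  add_pos_mem : ∀ α ∈ Pos, ∀ β ∈ Pos, α + β ∈ Δ → α + β ∈ Pos
  /-- the highest root `θ` -/
  θ : V
  θ_pos : θ ∈ Pos
  θ_highest : ∀ ν ∈ Δ, θ - ν ∈ AddSubmonoid.closure Pos

namespace RootSystemCtx

variable {V : Type*} [AddCommGroup V] [Module ℚ V] (ctx : RootSystemCtx V)

/-- the simple roots `Π`: indecomposable positive roots -/
def simple : Set V :=
  {α | α ∈ ctx.Pos ∧ ¬∃ β ∈ ctx.Pos, ∃ γ ∈ ctx.Pos, α = β + γ}

/-- `ρ`, the half-sum of all positive roots -/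
noncomputable def ρ : V :=
  (1 / 2 : ℚ) • ∑ α ∈ (ctx.Δ_finite.subset ctx.pos_subset).toFinset, α

/-- the coroot `μ∨ = 2μ/(μ,μ)` -/
noncomputable def coroot (μ : V) : V := (2 / ctx.B μ μ) • μ

/-- `Δ⁺_l`, the long positive roots (roots of the same length as `θ`) -/
def PosLong : Set V := {μ | μ ∈ ctx.Pos ∧ ctx.B μ μ = ctx.B ctx.θ ctx.θ}

/-- `Π_l`, the long simple roots -/
def SimpleLong : Set V := {μ | μ ∈ ctx.simple ∧ ctx.B μ μ = ctx.B ctx.θ ctx.θ}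

/-- the dominance order `μ ≼ ν` on the root lattice: `ν - μ` is a nonnegative
integer combination of positive roots -/
def le (μ ν : V) : Prop := ν - μ ∈ AddSubmonoid.closure ctx.Pos

/-- a (combinatorial) abelian ideal of `Δ⁺` -/
def IsAbelianIdeal (I : Set V) : Prop :=
  I ⊆ ctx.Pos ∧ (∀ μ ∈ I, ∀ ν ∈ I, μ + ν ∉ ctx.Δ) ∧
    ∀ γ ∈ I, ∀ ν ∈ ctx.Pos, γ + ν ∈ ctx.Δ → γ + ν ∈ I

/-- `γ` is a generator of the ideal `I` -/
def IsGenerator (I : Set V) (γ : V) : Prop := γ ∈ I ∧ ∀ α ∈ ctx.Pos, γ - α ∉ I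

/-! ### The affine picture: `V̂ = V ⊕ ℚδ ⊕ ℚλ`, modelled as `V × ℚ × ℚ`,
with `δ = (0,1,0)` and `λ = (0,0,1)`. -/

/-- the embedding of `V` into `V̂` -/
def emb (_ctx : RootSystemCtx V) (v : V) : V × ℚ × ℚ := (v, 0, 0)

/-- the imaginary root `δ` -/
def δhat (_ctx : RootSystemCtx V) : V × ℚ × ℚ := (0, 1, 0)

/-- the affine simple root `α₀ = δ - θ` -/
def alpha0 : V × ℚ × ℚ := (-ctx.θ, 1, 0)

/-- the extension of the inner product to `V̂`, with
`(δ,V)=(λ,V)=(δ,δ)=(λ,λ)=0` and `(δ,λ)=1` -/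
noncomputable def Bhat : (V × ℚ × ℚ) →ₗ[ℚ] (V × ℚ × ℚ) →ₗ[ℚ] ℚ :=
  LinearMap.mk₂ ℚ (fun x y => ctx.B x.1 y.1 + x.2.1 * y.2.2 + x.2.2 * y.2.1)
    (fun x x' y => by
      simp only [Prod.fst_add, Prod.snd_add, map_add, LinearMap.add_apply]; ring)
    (fun c x y => by
      simp only [Prod.smul_fst, Prod.smul_snd, map_smul, LinearMap.smul_apply,
        smul_eq_mul]; ring)
    (fun x y y' => by
      simp only [Prod.fst_add, Prod.snd_add, map_add]; ring)
    (fun c x y => by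
      simp only [Prod.smul_fst, Prod.smul_snd, map_smul, smul_eq_mul]; ring)

/-- the set `Δ̂` of affine real roots -/
def Δhat : Set (V × ℚ × ℚ) := {x | ∃ α ∈ ctx.Δ, ∃ k : ℤ, x = (α, (k : ℚ), 0)}

/-- the set `Δ̂⁺` of positive affine roots -/
def PosHat : Set (V × ℚ × ℚ) :=
  {x | ∃ α ∈ ctx.Pos, x = (α, 0, 0)} ∪
    {x | ∃ α ∈ ctx.Δ, ∃ k : ℤ, 1 ≤ k ∧ x = (α, (k : ℚ), 0)}

/-- the set `Π̂ = Π ∪ {α₀}` of affine simple roots -/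
def SimpleHat : Set (V × ℚ × ℚ) :=
  {x | ∃ α ∈ ctx.simple, x = (α, (0 : ℚ), (0 : ℚ))} ∪ {ctx.alpha0}

/-- the reflection `s_β : x ↦ x − (2(x,β)/(β,β))·β` in `V̂` -/
noncomputable def refl (β : V × ℚ × ℚ) : (V × ℚ × ℚ) ≃ₗ[ℚ] (V × ℚ × ℚ) :=
  if h : ctx.Bhat β β = 0 then LinearEquiv.refl ℚ _
  else
    Module.reflection (x := β) (f := (2 / ctx.Bhat β β) • ctx.Bhat β)
      (by simp only [LinearMap.smul_apply, smul_eq_mul]; field_simp)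

/-- the affine Weyl group `Ŵ`, generated by the reflections `s_β`, `β ∈ Δ̂` -/
def What : Subgroup ((V × ℚ × ℚ) ≃ₗ[ℚ] (V × ℚ × ℚ)) :=
  Subgroup.closure {g | ∃ β ∈ ctx.Δhat, g = ctx.refl β}

/-- the finite Weyl group `W`, generated by the reflections `s_α`, `α ∈ Δ`
(identified with a subgroup of `Ŵ`) -/
def Wfin : Subgroup ((V × ℚ × ℚ) ≃ₗ[ℚ] (V × ℚ × ℚ)) :=
  Subgroup.closure {g | ∃ α ∈ ctx.Δ, g = ctx.refl (α, (0 : ℚ), (0 : ℚ))}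

/-- `N̂(w) = {β ∈ Δ̂⁺ : w(β) ∈ −Δ̂⁺}` -/
def Nhat (w : (V × ℚ × ℚ) ≃ₗ[ℚ] (V × ℚ × ℚ)) : Set (V × ℚ × ℚ) :=
  {β | β ∈ ctx.PosHat ∧ -(w β) ∈ ctx.PosHat}

/-- a minuscule element of `Ŵ`: every element of `N̂(w)` has the form `δ - γ`
with `γ ∈ Δ⁺` -/
def IsMinuscule (w : (V × ℚ × ℚ) ≃ₗ[ℚ] (V × ℚ × ℚ)) : Prop :=
  w ∈ ctx.What ∧ ∀ β ∈ ctx.Nhat w, ∃ γ ∈ ctx.Pos, β = ctx.δhat - ctx.emb γ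

/-- the abelian ideal `I_w` corresponding to a minuscule element `w` -/
def idealOf (w : (V × ℚ × ℚ) ≃ₗ[ℚ] (V × ℚ × ℚ)) : Set V :=
  {γ | γ ∈ ctx.Pos ∧ ctx.δhat - ctx.emb γ ∈ ctx.Nhat w}

/-- the ideal `I` has rootlet `τ(I) = μ`, i.e. `I = I_w` for some minuscule `w`
with `w(α₀) + δ = μ` -/
def HasRootlet (I : Set V) (μ : V) : Prop :=
  ∃ w, ctx.IsMinuscule w ∧ ctx.idealOf w = I ∧ w ctx.alpha0 + ctx.δhat = ctx.emb μ

/-- `Ab_μ`, the set of nonempty abelian ideals with rootlet `μ` -/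
def AbFiber (μ : V) : Set (Set V) := {I | I.Nonempty ∧ ctx.HasRootlet I μ}

/-- `N(u) = {γ ∈ Δ⁺ : u(γ) ∈ −Δ⁺}` for `u` in the finite Weyl group -/
def Nfin (w : (V × ℚ × ℚ) ≃ₗ[ℚ] (V × ℚ × ℚ)) : Set V :=
  {γ | γ ∈ ctx.Pos ∧ -(w (ctx.emb γ)) ∈ ctx.PosHat}

/-- the length `l(u) = #N(u)` of an element of the finite Weyl group -/
noncomputable def lenFin (w : (V × ℚ × ℚ) ≃ₗ[ℚ] (V × ℚ × ℚ)) : ℕ :=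
  (ctx.Nfin w).ncard

end RootSystemCtx

namespace RootSystemCtx

variable {V : Type*} [AddCommGroup V] [Module ℚ V] (ctx : RootSystemCtx V)

/-- the Cartan pairing `⟨x, α∨⟩ = 2 (x, α) / (α, α)` -/
noncomputable def pairing (x α : V) : ℚ := 2 * ctx.B x α / ctx.B α α

/-- the reflection of `V` in the root `α` -/
noncomputable def reflect (α x : V) : V := x - ctx.pairing x α • α

section Finite

variable {ctx}

lemma ne_zero_of_mem {α : V} (h : α ∈ ctx.Δ) : α ≠ 0 := fun h0 => ctx.zero_notMem_Δ (h0 ▸ h)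

lemma B_self_pos {α : V} (h : α ∈ ctx.Δ) : 0 < ctx.B α α := ctx.B_posdef α (ne_zero_of_mem h)

lemma pairing_add (x y α : V) :
    ctx.pairing (x + y) α = ctx.pairing x α + ctx.pairing y α := by
  simp only [pairing, map_add, LinearMap.add_apply]; ring

lemma pairing_neg (x α : V) : ctx.pairing (-x) α = -ctx.pairing x α := by
  simp only [pairing, map_neg, LinearMap.neg_apply]; ring

lemma pairing_smul (c : ℚ) (x α : V) : ctx.pairing (c • x) α = c * ctx.pairing x α := by
  simp only [pairing, map_smul, LinearMap.smul_apply, smul_eq_mul]; ring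

lemma pairing_sub (x y α : V) :
    ctx.pairing (x - y) α = ctx.pairing x α - ctx.pairing y α := by
  simp only [pairing, map_sub, LinearMap.sub_apply]; ring

lemma pairing_self {α : V} (h : α ∈ ctx.Δ) : ctx.pairing α α = 2 := by
  have := B_self_pos h
  rw [pairing]; field_simp

lemma pairing_mul {α : V} (x : V) (h : α ∈ ctx.Δ) :
    ctx.pairing x α * ctx.B α α = 2 * ctx.B x α := by
  have := B_self_pos h
  rw [pairing]; field_simp

lemma pairing_reflect {α : V} (x : V) (h : α ∈ ctx.Δ) :
    ctx.pairing (ctx.reflect α x) α = -ctx.pairing x α := by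
  rw [reflect, pairing_sub, pairing_smul, pairing_self h]; ring

lemma reflect_reflect {α : V} (x : V) (h : α ∈ ctx.Δ) :
    ctx.reflect α (ctx.reflect α x) = x := by
  rw [reflect, pairing_reflect x h, reflect]; module

lemma reflect_self {α : V} (h : α ∈ ctx.Δ) : ctx.reflect α α = -α := by
  rw [reflect, pairing_self h]; module

lemma reflect_mem_Δ {α β : V} (hα : α ∈ ctx.Δ) (hβ : β ∈ ctx.Δ) : ctx.reflect α β ∈ ctx.Δ :=
  ctx.reflect_mem α hα β hβ

lemma exists_int_pairing {α β : V} (hα : α ∈ ctx.Δ) (hβ : β ∈ ctx.Δ) :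
    ∃ n : ℤ, ctx.pairing β α = n := ctx.crystallographic β hβ α hα

lemma B_reflect_reflect {α : V} (x y : V) (h : α ∈ ctx.Δ) :
    ctx.B (ctx.reflect α x) (ctx.reflect α y) = ctx.B x y := by
  have hx := pairing_mul x h
  have hy := pairing_mul y h
  simp only [reflect, map_sub, map_smul, LinearMap.sub_apply, LinearMap.smul_apply, smul_eq_mul,
    ctx.B_symm α y]
  linear_combination ctx.pairing y α / 2 * hx + ctx.pairing x α / 2 * hy

/-- the strict Cauchy–Schwarz inequality for two non-proportional roots -/
lemma B_sq_lt {α β : V} (hα : α ∈ ctx.Δ) (hβ : β ∈ ctx.Δ) (h₁ : α ≠ β) (h₂ : α ≠ -β) :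
    ctx.B α β * ctx.B α β < ctx.B α α * ctx.B β β := by
  have hb := B_self_pos hβ
  have hne : ctx.B β β • α - ctx.B α β • β ≠ 0 := by
    intro h
    have e : α = (ctx.B α β / ctx.B β β) • β := by
      have : ctx.B β β • α = ctx.B α β • β := sub_eq_zero.1 h
      rw [div_eq_inv_mul, mul_smul, ← this, smul_smul, inv_mul_cancel₀ hb.ne', one_smul]
    rcases ctx.reduced β hβ _ (e ▸ hα) with h' | h'
    · rw [h', one_smul] at e; exact h₁ e
    · rw [h', neg_one_smul] at e; exact h₂ e
  have := ctx.B_posdef _ hne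
  simp only [map_sub, map_smul, LinearMap.sub_apply, LinearMap.smul_apply, smul_eq_mul,
    ctx.B_symm β α] at this
  have : 0 < ctx.B β β * (ctx.B α α * ctx.B β β - ctx.B α β * ctx.B α β) := by linarith
  have := pos_of_mul_pos_right this hb.le
  linarith

lemma add_mem_of_B_neg {α β : V} (hα : α ∈ ctx.Δ) (hβ : β ∈ ctx.Δ) (h : ctx.B α β < 0)
    (hne : α ≠ -β) : α + β ∈ ctx.Δ := by
  have ha := B_self_pos hα
  have hb := B_self_pos hβ
  have hlt := B_sq_lt hα hβ (by rintro rfl; linarith) hne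
  obtain ⟨n, hn⟩ := exists_int_pairing hβ hα
  obtain ⟨m, hm⟩ := exists_int_pairing hα hβ
  have en := pairing_mul α hβ
  have em := pairing_mul β hα
  rw [hn] at en
  rw [hm, ctx.B_symm β α] at em
  have hn0 : n < 0 := by
    have : (n : ℚ) < 0 := by by_contra hc; push Not at hc; nlinarith
    exact_mod_cast this
  have hm0 : m < 0 := by
    have : (m : ℚ) < 0 := by by_contra hc; push Not at hc; nlinarith
    exact_mod_cast this
  have hnm : n * m < 4 := by
    have h1 : (n * m : ℚ) * (ctx.B α α * ctx.B β β) = 4 * (ctx.B α β * ctx.B α β) := by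
      linear_combination (m * ctx.B α α) * en + 2 * ctx.B α β * em
    have h2 : (n * m : ℚ) < 4 := by
      by_contra hc; push Not at hc
      nlinarith [mul_pos ha hb]
    exact_mod_cast h2
  have : n = -1 ∨ m = -1 := by
    by_contra! hc
    have h1 : n ≤ -2 := by omega
    have h2 : m ≤ -2 := by omega
    nlinarith
  rcases this with h' | h'
  · have := reflect_mem_Δ hβ hα
    rw [reflect, hn, h'] at this
    convert this using 1; push_cast; module
  · have := reflect_mem_Δ hα hβ
    rw [reflect, hm, h'] at this
    convert this using 1; push_cast; module

lemma sub_mem_of_B_pos {α β : V} (hα : α ∈ ctx.Δ) (hβ : β ∈ ctx.Δ) (h : 0 < ctx.B α β)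
    (hne : α ≠ β) : α - β ∈ ctx.Δ := by
  rw [sub_eq_add_neg]
  exact add_mem_of_B_neg hα (ctx.neg_mem_Δ β hβ) (by simpa using h) (by simpa using hne)

lemma pos_mem {α : V} (h : α ∈ ctx.Pos) : α ∈ ctx.Δ := ctx.pos_subset h

lemma multiset_sum_ne_zero (n : ℕ) : ∀ s : Multiset V, s.card = n → (∀ x ∈ s, x ∈ ctx.Pos) →
    s ≠ 0 → s.sum ≠ 0 := by
  induction n with
  | zero => intro s hs _ h0; exact absurd (Multiset.card_eq_zero.1 hs) h0
  | succ n ih =>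
    intro s hs hpos h0 hsum
    obtain ⟨a, ha⟩ := Multiset.exists_mem_of_ne_zero h0
    obtain ⟨t, rfl⟩ := Multiset.exists_cons_of_mem ha
    replace ha : a ∈ ctx.Pos := hpos a ha
    have hB : ctx.B a a + (t.map (ctx.B a)).sum = 0 := by
      rw [← map_multiset_sum, ← map_add, ← Multiset.sum_cons, hsum, map_zero]
    have haa := B_self_pos (pos_mem ha)
    obtain ⟨b, hb, hab⟩ : ∃ b ∈ t, ctx.B a b < 0 := by
      by_contra! hc
      have : 0 ≤ (t.map (ctx.B a)).sum := Multiset.sum_nonneg (by simpa using hc)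
      linarith
    have hbp : b ∈ ctx.Pos := hpos b (Multiset.mem_cons_of_mem hb)
    have hadd : a + b ∈ ctx.Pos := ctx.add_pos_mem a ha b hbp
      (add_mem_of_B_neg (pos_mem ha) (pos_mem hbp) hab
        (fun h => ctx.pos_not_neg b hbp (h ▸ ha)))
    obtain ⟨t', rfl⟩ := Multiset.exists_cons_of_mem hb
    refine ih ((a + b) ::ₘ t') ?_ ?_ (Multiset.cons_ne_zero) ?_
    · simpa using hs
    · intro x hx
      rcases Multiset.mem_cons.1 hx with rfl | hx
      · exact hadd
      · exact hpos x (by simp [hx])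
    · simpa [add_assoc] using hsum

lemma add_ne_zero_of_mem_closure {x α : V} (hx : x ∈ AddSubmonoid.closure ctx.Pos)
    (hα : α ∈ ctx.Pos) : x + α ≠ 0 := by
  obtain ⟨s, hs, rfl⟩ := AddSubmonoid.exists_multiset_of_mem_closure hx
  have := multiset_sum_ne_zero (ctx := ctx) _ (α ::ₘ s) rfl
    (by simpa [hα] using hs) Multiset.cons_ne_zero
  rwa [Multiset.sum_cons, add_comm] at this

lemma pairing_pos_of_reflect_notMem {α γ : V} (hα : α ∈ ctx.Pos) (hγ : γ ∈ ctx.Pos)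
    (h : ctx.reflect α γ ∉ ctx.Pos) : 0 < ctx.pairing γ α := by
  by_contra! hc
  obtain ⟨n, hn⟩ := exists_int_pairing (pos_mem hα) (pos_mem hγ)
  have hn0 : n ≤ 0 := by rw [hn] at hc; exact_mod_cast hc
  obtain ⟨k, rfl⟩ : ∃ k : ℕ, n = -k := ⟨n.natAbs, by omega⟩
  have hneg := (ctx.mem_pos_or_neg_pos _ (reflect_mem_Δ (pos_mem hα) (pos_mem hγ))).resolve_left h
  refine add_ne_zero_of_mem_closure (ctx := ctx) (x := k • α + γ) (add_mem (nsmul_mem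
    (AddSubmonoid.subset_closure hα) k) (AddSubmonoid.subset_closure hγ)) hneg ?_
  rw [reflect, hn, ← Nat.cast_smul_eq_nsmul ℚ]
  push_cast
  module

variable (ctx) in
lemma pos_finite : ctx.Pos.Finite := ctx.Δ_finite.subset ctx.pos_subset

lemma two_B_ρ (x : V) : 2 * ctx.B ctx.ρ x = ∑ γ ∈ ctx.pos_finite.toFinset, ctx.B γ x := by
  rw [ρ, map_smul, LinearMap.smul_apply, map_sum, LinearMap.sum_apply, smul_eq_mul]
  ring

lemma B_ρ_pos {α : V} (hα : α ∈ ctx.Pos) : 0 < ctx.B ctx.ρ α := by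
  classical
  have hαΔ := pos_mem hα
  have h2 := two_B_ρ (ctx := ctx) α
  rw [← Finset.sum_filter_add_sum_filter_not _ (fun γ => ctx.reflect α γ ∈ ctx.Pos)] at h2
  have hB : ∀ γ, ctx.B (ctx.reflect α γ) α = -ctx.B γ α := fun γ => by
    have h1 := pairing_reflect γ hαΔ
    have h2 := pairing_mul γ hαΔ
    have h3 := pairing_mul (ctx.reflect α γ) hαΔ
    rw [h1] at h3; linarith
  have h0 : ∑ γ ∈ ctx.pos_finite.toFinset with ctx.reflect α γ ∈ ctx.Pos, ctx.B γ α = 0 := by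
    refine eq_zero_of_neg_eq ?_
    rw [← Finset.sum_neg_distrib]
    refine Finset.sum_nbij' (ctx.reflect α) (ctx.reflect α) ?_ ?_ ?_ ?_ ?_
    · intro γ; simp only [Finset.mem_filter, Set.Finite.mem_toFinset, reflect_reflect _ hαΔ]
      tauto
    · intro γ; simp only [Finset.mem_filter, Set.Finite.mem_toFinset, reflect_reflect _ hαΔ]
      tauto
    · intro γ _; exact reflect_reflect _ hαΔ
    · intro γ _; exact reflect_reflect _ hαΔ
    · intro γ _; exact (hB γ).symm
  have h1 : 0 < ∑ γ ∈ ctx.pos_finite.toFinset with ctx.reflect α γ ∉ ctx.Pos, ctx.B γ α := by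
    refine Finset.sum_pos ?_ ⟨α, ?_⟩
    · intro γ hγ
      simp only [Finset.mem_filter, Set.Finite.mem_toFinset] at hγ
      have := pairing_pos_of_reflect_notMem hα hγ.1 hγ.2
      have h3 := pairing_mul γ hαΔ
      have := mul_pos this (B_self_pos hαΔ)
      linarith
    · simp only [Finset.mem_filter, Set.Finite.mem_toFinset, reflect_self hαΔ]
      exact ⟨hα, ctx.pos_not_neg α hα⟩
  linarith

lemma pos_iff {α : V} (h : α ∈ ctx.Δ) : α ∈ ctx.Pos ↔ 0 < ctx.B ctx.ρ α := by
  refine ⟨B_ρ_pos, fun h' => (ctx.mem_pos_or_neg_pos α h).resolve_right fun hn => ?_⟩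
  have := B_ρ_pos hn
  rw [map_neg] at this
  linarith

lemma neg_pos_iff {α : V} (h : α ∈ ctx.Δ) : -α ∈ ctx.Pos ↔ ctx.B ctx.ρ α < 0 := by
  rw [pos_iff (ctx.neg_mem_Δ α h), map_neg, neg_pos]

lemma nonneg_of_mem_closure {M : Type*} [AddCommGroup M] [Module ℚ M] (φ : M →ₗ[ℚ] ℚ)
    {S : Set M} (h : ∀ α ∈ S, 0 ≤ φ α) {x : M} (hx : x ∈ AddSubmonoid.closure S) : 0 ≤ φ x := by
  induction hx using AddSubmonoid.closure_induction with
  | mem x hx => exact h x hx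
  | zero => simp
  | add x y _ _ hx hy => rw [map_add]; exact add_nonneg hx hy

lemma B_ρ_le {α : V} (h : α ∈ ctx.Δ) : ctx.B ctx.ρ α ≤ ctx.B ctx.ρ ctx.θ := by
  have := nonneg_of_mem_closure (ctx.B ctx.ρ) (fun α hα => (B_ρ_pos hα).le)
    (ctx.θ_highest α h)
  rw [map_sub] at this
  linarith

variable (ctx) in
lemma θ_mem : ctx.θ ∈ ctx.Δ := pos_mem ctx.θ_pos

/-- a root of maximal `(ρ, ·)` among the roots of its length is dominant -/
lemma B_nonneg_of_maximal {a α : V} (ha : a ∈ ctx.Δ)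
    (hmax : ∀ b ∈ ctx.Δ, ctx.B b b = ctx.B a a → ctx.B ctx.ρ b ≤ ctx.B ctx.ρ a)
    (hα : α ∈ ctx.Pos) : 0 ≤ ctx.B a α := by
  have := hmax _ (reflect_mem_Δ (pos_mem hα) ha) (B_reflect_reflect _ _ (pos_mem hα))
  rw [reflect, map_sub, map_smul, smul_eq_mul] at this
  have h1 := B_ρ_pos hα
  have h2 : 0 ≤ ctx.pairing a α := by by_contra! hc; nlinarith
  have h3 := pairing_mul a (pos_mem hα)
  have := mul_nonneg h2 (B_self_pos (pos_mem hα)).le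
  linarith

lemma B_θ_nonneg {α : V} (hα : α ∈ ctx.Pos) : 0 ≤ ctx.B ctx.θ α :=
  B_nonneg_of_maximal ctx.θ_mem (fun _ hb _ => B_ρ_le hb) hα

lemma B_self_le {α : V} (h : α ∈ ctx.Δ) : ctx.B α α ≤ ctx.B ctx.θ ctx.θ := by
  obtain ⟨a, ⟨ha, hl⟩, hmax⟩ := Set.exists_max_image {b | b ∈ ctx.Δ ∧ ctx.B b b = ctx.B α α}
    (ctx.B ctx.ρ) (ctx.Δ_finite.subset fun _ h => h.1) ⟨α, h, rfl⟩
  have hdom : ∀ γ ∈ ctx.Pos, 0 ≤ ctx.B a γ := fun γ hγ =>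
    B_nonneg_of_maximal ha (fun b hb hbl => hmax b ⟨hb, hbl.trans hl⟩) hγ
  have h1 := nonneg_of_mem_closure (ctx.B a) hdom (ctx.θ_highest a ha)
  have h2 := nonneg_of_mem_closure (ctx.B ctx.θ) (fun _ h => B_θ_nonneg h) (ctx.θ_highest a ha)
  rw [map_sub] at h1 h2
  rw [ctx.B_symm a ctx.θ] at h1
  linarith

lemma pairing_θ_nonneg {α : V} (hα : α ∈ ctx.Pos) : 0 ≤ ctx.pairing α ctx.θ := by
  rw [pairing, ctx.B_symm]
  exact div_nonneg (mul_nonneg two_pos.le (B_θ_nonneg hα)) (B_self_pos ctx.θ_mem).le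

lemma pos_of_pairing_θ_pos {α : V} (hα : α ∈ ctx.Δ) (h : 0 < ctx.pairing α ctx.θ) :
    α ∈ ctx.Pos := by
  refine (ctx.mem_pos_or_neg_pos α hα).resolve_right fun hn => ?_
  have := pairing_θ_nonneg hn
  rw [pairing_neg] at this
  linarith

/-- the pairing of a root with a long coroot -/
lemma pairing_long_cases {μ α : V} (hμ : μ ∈ ctx.Δ) (hl : ctx.B μ μ = ctx.B ctx.θ ctx.θ)
    (hα : α ∈ ctx.Δ) (h₁ : α ≠ μ) (h₂ : α ≠ -μ) :
    ctx.pairing α μ = -1 ∨ ctx.pairing α μ = 0 ∨ ctx.pairing α μ = 1 := by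
  obtain ⟨n, hn⟩ := exists_int_pairing hμ hα
  have h3 := B_sq_lt hα hμ h₁ h₂
  have h4 := B_self_le hα
  have h5 := pairing_mul α hμ
  have h6 := B_self_pos hμ
  have h7 : (n * n : ℚ) < 4 := by
    rw [hn] at h5
    have : (n * n : ℚ) * (ctx.B μ μ * ctx.B μ μ) = 4 * (ctx.B α μ * ctx.B α μ) := by
      linear_combination (n * ctx.B μ μ) * h5 + 2 * ctx.B α μ * h5
    by_contra! hc
    nlinarith [mul_pos h6 h6]
  have h8 : n * n < 4 := by exact_mod_cast h7
  have h9 : -2 < n := by nlinarith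
  have h10 : n < 2 := by nlinarith
  rw [hn]
  have : n = -1 ∨ n = 0 ∨ n = 1 := by omega
  rcases this with rfl | rfl | rfl <;> simp

lemma B_sub_simple_pos {α γ : V} (hα : α ∈ ctx.simple) (hγ : γ ∈ ctx.Pos) (hne : γ ≠ α)
    (h : 0 < ctx.B γ α) : γ - α ∈ ctx.Pos := by
  have hm := sub_mem_of_B_pos (pos_mem hγ) (pos_mem hα.1) h hne
  refine (ctx.mem_pos_or_neg_pos _ hm).resolve_right fun hn => hα.2 ⟨γ, hγ, _, hn, by abel⟩

/-- a simple reflection permutes the other positive roots -/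
lemma reflect_simple_pos {α γ : V} (hα : α ∈ ctx.simple) (hγ : γ ∈ ctx.Pos) (hne : γ ≠ α) :
    ctx.reflect α γ ∈ ctx.Pos := by
  by_contra hc
  have hαΔ := pos_mem hα.1
  have hγΔ := pos_mem hγ
  have hm := pairing_pos_of_reflect_notMem hα.1 hγ hc
  have hneg := (ctx.mem_pos_or_neg_pos _ (reflect_mem_Δ hαΔ hγΔ)).resolve_left hc
  have hBpos : ∀ x, 0 < ctx.pairing x α → 0 < ctx.B x α := fun x hx => by
    have := mul_pos hx (B_self_pos hαΔ)
    rw [pairing_mul x hαΔ] at this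
    linarith
  have h1 := B_sub_simple_pos hα hγ hne (hBpos _ hm)
  have h2 : -ctx.reflect α γ - α ∈ ctx.Pos := by
    refine B_sub_simple_pos hα hneg (fun h => hne ?_) (hBpos _ ?_)
    · have := congrArg (ctx.reflect α) (neg_eq_iff_eq_neg.1 h)
      rw [reflect_reflect _ hαΔ, ← reflect_self hαΔ, reflect_reflect _ hαΔ] at this
      exact this
    · rw [pairing_neg, pairing_reflect _ hαΔ, neg_neg]; exact hm
  obtain ⟨n, hn⟩ := exists_int_pairing hαΔ hγΔ
  have hsum : (γ - α) + (-ctx.reflect α γ - α) = ((n : ℚ) - 2) • α := by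
    rw [reflect, hn]; module
  have hρ1 := B_ρ_pos h1
  have hρ2 := B_ρ_pos h2
  have hρ3 := B_ρ_pos hα.1
  have e := congrArg (ctx.B ctx.ρ) hsum
  rw [map_add, map_smul, smul_eq_mul] at e
  have hn3 : 2 < n := by
    have : (2 : ℚ) < n := by by_contra! h; nlinarith
    exact_mod_cast this
  have hn4 : n < 4 := by
    have hγα : γ ≠ -α := fun h => ctx.pos_not_neg α hα.1 (h ▸ hγ)
    have h3 := B_sq_lt hγΔ hαΔ hne hγα
    have h4 := pairing_mul γ hαΔ
    have h5 := pairing_mul α hγΔ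
    obtain ⟨m, hm'⟩ := exists_int_pairing hγΔ hαΔ
    rw [hn] at h4
    rw [hm', ctx.B_symm α γ] at h5
    have ha := B_self_pos hαΔ
    have hg := B_self_pos hγΔ
    have hb := hBpos _ hm
    have hm0 : 1 ≤ m := by
      have : (0 : ℚ) < m := by by_contra! h; nlinarith
      exact_mod_cast this
    have h6 : (n * m : ℚ) * (ctx.B γ γ * ctx.B α α) = 4 * (ctx.B γ α * ctx.B γ α) := by
      linear_combination (m * ctx.B γ γ) * h4 + 2 * ctx.B γ α * h5
    have h7 : (n * m : ℚ) < 4 := by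
      by_contra! h
      nlinarith [mul_pos ha hg]
    have h8 : n * m < 4 := by exact_mod_cast h7
    nlinarith
  obtain rfl : n = 3 := by omega
  refine hα.2 ⟨_, h1, _, h2, ?_⟩
  rw [hsum]; push_cast; module

lemma pos_subset_closure_simple : ctx.Pos ⊆ AddSubmonoid.closure ctx.simple := by
  by_contra hc
  obtain ⟨a, ha, hna⟩ := Set.not_subset.1 hc
  obtain ⟨γ, ⟨hγ, hγn⟩, hmin⟩ := Set.exists_min_image
    {b | b ∈ ctx.Pos ∧ b ∉ AddSubmonoid.closure ctx.simple}
    (ctx.B ctx.ρ) (ctx.pos_finite.subset fun _ h => h.1) ⟨a, ha, hna⟩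
  have hdec : ∃ β ∈ ctx.Pos, ∃ γ' ∈ ctx.Pos, γ = β + γ' := by
    by_contra h
    exact hγn (AddSubmonoid.subset_closure ⟨hγ, h⟩)
  obtain ⟨β, hβ, γ', hγ', rfl⟩ := hdec
  have h1 := B_ρ_pos hβ
  have h2 := B_ρ_pos hγ'
  refine hγn (add_mem ?_ ?_)
  · by_contra h
    have := hmin β ⟨hβ, h⟩
    rw [map_add] at this; linarith
  · by_contra h
    have := hmin γ' ⟨hγ', h⟩
    rw [map_add] at this; linarith

end Finite

section Affine

variable {ctx}

lemma Bhat_apply (x y : V × ℚ × ℚ) :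
    ctx.Bhat x y = ctx.B x.1 y.1 + x.2.1 * y.2.2 + x.2.2 * y.2.1 := rfl

lemma Bhat_symm (x y : V × ℚ × ℚ) : ctx.Bhat x y = ctx.Bhat y x := by
  rw [Bhat_apply, Bhat_apply, ctx.B_symm]; ring

lemma refl_apply (β x : V × ℚ × ℚ) :
    ctx.refl β x = x - (2 * ctx.Bhat β x / ctx.Bhat β β) • β := by
  unfold refl
  split_ifs with h
  · simp [h]
  · rw [Module.reflection_apply, LinearMap.smul_apply, smul_eq_mul, div_mul_eq_mul_div]

lemma Bhat_refl_refl (β x y : V × ℚ × ℚ) :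
    ctx.Bhat (ctx.refl β x) (ctx.refl β y) = ctx.Bhat x y := by
  by_cases h : ctx.Bhat β β = 0
  · simp [refl_apply, h]
  · simp only [refl_apply, map_sub, map_smul, LinearMap.sub_apply, LinearMap.smul_apply,
      smul_eq_mul, Bhat_symm x β]
    field_simp
    ring

lemma refl_neg (β : V × ℚ × ℚ) : ctx.refl (-β) = ctx.refl β := by
  ext1 x
  simp only [refl_apply, map_neg, LinearMap.neg_apply, neg_neg, mul_neg, neg_div, smul_neg,
    neg_smul]

lemma conj_refl {z : (V × ℚ × ℚ) ≃ₗ[ℚ] (V × ℚ × ℚ)}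
    (hz : ∀ x y, ctx.Bhat (z x) (z y) = ctx.Bhat x y) (β : V × ℚ × ℚ) :
    ctx.refl (z β) * z = z * ctx.refl β := by
  ext1 x
  simp only [LinearEquiv.mul_apply, refl_apply, map_sub, map_smul, hz]

lemma fst_mem_of_mem_Δhat {x : V × ℚ × ℚ} (h : x ∈ ctx.Δhat) : x.1 ∈ ctx.Δ := by
  obtain ⟨α, hα, k, rfl⟩ := h; exact hα

lemma snd_snd_of_mem_Δhat {x : V × ℚ × ℚ} (h : x ∈ ctx.Δhat) : x.2.2 = 0 := by
  obtain ⟨α, hα, k, rfl⟩ := h; rfl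

lemma refl_eq {β x : V × ℚ × ℚ} (hβ : β.2.2 = 0) (hx : x.2.2 = 0) :
    ctx.refl β x =
      (ctx.reflect β.1 x.1, x.2.1 - ctx.pairing x.1 β.1 * β.2.1, 0) := by
  rw [refl_apply, Bhat_apply, Bhat_apply, hβ, hx, ctx.B_symm β.1 x.1]
  ext <;> simp [reflect, pairing, hβ, hx]

lemma Bhat_self_pos {β : V × ℚ × ℚ} (h : β ∈ ctx.Δhat) : 0 < ctx.Bhat β β := by
  rw [Bhat_apply, snd_snd_of_mem_Δhat h]
  simpa using B_self_pos (fst_mem_of_mem_Δhat h)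

lemma refl_self {β : V × ℚ × ℚ} (h : β ∈ ctx.Δhat) : ctx.refl β β = -β := by
  have := Bhat_self_pos h
  rw [refl_apply, mul_div_assoc, div_self this.ne']
  module

lemma refl_refl {β : V × ℚ × ℚ} (h : β ∈ ctx.Δhat) (x : V × ℚ × ℚ) :
    ctx.refl β (ctx.refl β x) = x := by
  rw [refl_apply β x, map_sub, map_smul, refl_self h, refl_apply]
  module

lemma refl_mul_self {β : V × ℚ × ℚ} (h : β ∈ ctx.Δhat) : ctx.refl β * ctx.refl β = 1 := by
  ext1 x
  exact refl_refl h x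

lemma refl_inv {β : V × ℚ × ℚ} (h : β ∈ ctx.Δhat) : (ctx.refl β)⁻¹ = ctx.refl β :=
  inv_eq_of_mul_eq_one_left (refl_mul_self h)

lemma refl_mem_Δhat {β x : V × ℚ × ℚ} (hβ : β ∈ ctx.Δhat) (hx : x ∈ ctx.Δhat) :
    ctx.refl β x ∈ ctx.Δhat := by
  rw [refl_eq (snd_snd_of_mem_Δhat hβ) (snd_snd_of_mem_Δhat hx)]
  obtain ⟨b, hb, k, rfl⟩ := hβ
  obtain ⟨a, ha, l, rfl⟩ := hx
  obtain ⟨n, hn⟩ := exists_int_pairing hb ha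
  refine ⟨_, reflect_mem_Δ hb ha, l - n * k, ?_⟩
  simp [hn]

lemma refl_mem_Δhat_iff {β : V × ℚ × ℚ} (hβ : β ∈ ctx.Δhat) (x : V × ℚ × ℚ) :
    ctx.refl β x ∈ ctx.Δhat ↔ x ∈ ctx.Δhat :=
  ⟨fun h => refl_refl hβ x ▸ refl_mem_Δhat hβ h, refl_mem_Δhat hβ⟩

lemma neg_mem_Δhat {x : V × ℚ × ℚ} (h : x ∈ ctx.Δhat) : -x ∈ ctx.Δhat := by
  obtain ⟨a, ha, l, rfl⟩ := h
  exact ⟨-a, ctx.neg_mem_Δ a ha, -l, by simp⟩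

lemma emb_mem_Δhat {α : V} (h : α ∈ ctx.Δ) : ctx.emb α ∈ ctx.Δhat := ⟨α, h, 0, by simp [emb]⟩

variable (ctx) in
lemma alpha0_mem_Δhat : ctx.alpha0 ∈ ctx.Δhat :=
  ⟨-ctx.θ, ctx.neg_mem_Δ _ ctx.θ_mem, 1, by simp [alpha0]⟩

lemma alpha0_eq : ctx.alpha0 = ctx.δhat - ctx.emb ctx.θ := by
  simp [alpha0, δhat, emb]

section Group

variable {z : (V × ℚ × ℚ) ≃ₗ[ℚ] (V × ℚ × ℚ)}

lemma Bhat_What (hz : z ∈ ctx.What) (x y : V × ℚ × ℚ) :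
    ctx.Bhat (z x) (z y) = ctx.Bhat x y := by
  induction hz using Subgroup.closure_induction generalizing x y with
  | mem g hg => obtain ⟨β, _, rfl⟩ := hg; exact Bhat_refl_refl β x y
  | one => rfl
  | mul g h _ _ hg hh => rw [LinearEquiv.mul_apply, LinearEquiv.mul_apply, hg, hh]
  | inv g _ hg =>
    rw [← hg, ← LinearEquiv.mul_apply, ← LinearEquiv.mul_apply, mul_inv_cancel]; rfl

lemma mem_Δhat_What (hz : z ∈ ctx.What) (x : V × ℚ × ℚ) : z x ∈ ctx.Δhat ↔ x ∈ ctx.Δhat := by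
  induction hz using Subgroup.closure_induction generalizing x with
  | mem g hg => obtain ⟨β, hβ, rfl⟩ := hg; exact refl_mem_Δhat_iff hβ x
  | one => rfl
  | mul g h _ _ hg hh => rw [LinearEquiv.mul_apply, hg, hh]
  | inv g _ hg =>
    rw [← hg, ← LinearEquiv.mul_apply, mul_inv_cancel]; rfl

lemma apply_inv_apply (z : (V × ℚ × ℚ) ≃ₗ[ℚ] (V × ℚ × ℚ)) (x : V × ℚ × ℚ) :
    z (z⁻¹ x) = x := by
  rw [← LinearEquiv.mul_apply, mul_inv_cancel]; rfl

lemma inv_apply_apply (z : (V × ℚ × ℚ) ≃ₗ[ℚ] (V × ℚ × ℚ)) (x : V × ℚ × ℚ) :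
    z⁻¹ (z x) = x := by
  rw [← LinearEquiv.mul_apply, inv_mul_cancel]; rfl

lemma refl_δhat {β : V × ℚ × ℚ} (h : β ∈ ctx.Δhat) : ctx.refl β ctx.δhat = ctx.δhat := by
  rw [refl_apply, Bhat_apply, snd_snd_of_mem_Δhat h]
  simp [δhat]

lemma What_δhat (hz : z ∈ ctx.What) : z ctx.δhat = ctx.δhat := by
  induction hz using Subgroup.closure_induction with
  | mem g hg => obtain ⟨β, hβ, rfl⟩ := hg; exact refl_δhat hβ
  | one => rfl
  | mul g h _ _ hg hh => rw [LinearEquiv.mul_apply, hh, hg]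
  | inv g _ hg => conv_lhs => rw [← hg, inv_apply_apply]

lemma Wfin_le_What : ctx.Wfin ≤ ctx.What := by
  refine Subgroup.closure_mono ?_
  rintro _ ⟨α, hα, rfl⟩
  exact ⟨_, emb_mem_Δhat hα, rfl⟩

lemma refl_mem_What {β : V × ℚ × ℚ} (h : β ∈ ctx.Δhat) : ctx.refl β ∈ ctx.What :=
  Subgroup.subset_closure ⟨β, h, rfl⟩

lemma refl_emb_mem_Wfin {α : V} (h : α ∈ ctx.Δ) : ctx.refl (ctx.emb α) ∈ ctx.Wfin :=
  Subgroup.subset_closure ⟨α, h, rfl⟩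

lemma snd_Wfin (hz : z ∈ ctx.Wfin) (x : V × ℚ × ℚ) : (z x).2.1 = x.2.1 := by
  induction hz using Subgroup.closure_induction generalizing x with
  | mem g hg => obtain ⟨α, hα, rfl⟩ := hg; simp [refl_apply]
  | one => rfl
  | mul g h _ _ hg hh => rw [LinearEquiv.mul_apply, hg, hh]
  | inv g _ hg => rw [← hg, apply_inv_apply]

end Group

variable (ctx) in
/-- a linear functional on `V̂` that detects the positivity of affine roots -/
noncomputable def htHat : (V × ℚ × ℚ) →ₗ[ℚ] ℚ :=
  (ctx.B ctx.ρ).comp (LinearMap.fst ℚ V (ℚ × ℚ)) +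
    (ctx.B ctx.ρ ctx.θ + 1) • (LinearMap.fst ℚ ℚ ℚ).comp (LinearMap.snd ℚ V (ℚ × ℚ))

lemma htHat_apply (x : V × ℚ × ℚ) :
    ctx.htHat x = ctx.B ctx.ρ x.1 + (ctx.B ctx.ρ ctx.θ + 1) * x.2.1 := rfl

lemma mem_Δhat_of_mem_PosHat {x : V × ℚ × ℚ} (h : x ∈ ctx.PosHat) : x ∈ ctx.Δhat := by
  rcases h with ⟨α, hα, rfl⟩ | ⟨α, hα, k, _, rfl⟩
  · exact ⟨α, pos_mem hα, 0, by simp⟩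
  · exact ⟨α, hα, k, rfl⟩

lemma neg_B_ρ_le {α : V} (h : α ∈ ctx.Δ) : -ctx.B ctx.ρ ctx.θ ≤ ctx.B ctx.ρ α := by
  have := B_ρ_le (ctx.neg_mem_Δ α h)
  rw [map_neg] at this
  linarith

lemma posHat_iff {x : V × ℚ × ℚ} (h : x ∈ ctx.Δhat) : x ∈ ctx.PosHat ↔ 0 < ctx.htHat x := by
  have hθ := B_ρ_pos ctx.θ_pos
  rw [htHat_apply]
  constructor
  · rintro (⟨α, hα, rfl⟩ | ⟨α, hα, k, hk, rfl⟩)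
    · simpa using B_ρ_pos hα
    · have h1 : (1 : ℚ) ≤ k := by exact_mod_cast hk
      have := neg_B_ρ_le hα
      simp only
      nlinarith
  · obtain ⟨α, hα, k, rfl⟩ := h
    intro hp
    simp only at hp
    rcases lt_trichotomy k 0 with hk | rfl | hk
    · have h1 : (k : ℚ) ≤ -1 := by exact_mod_cast Int.le_sub_one_of_lt hk
      have := B_ρ_le hα
      nlinarith
    · left
      exact ⟨α, (pos_iff hα).2 (by simpa using hp), by simp⟩
    · right
      exact ⟨α, hα, k, hk, rfl⟩

lemma htHat_pos {x : V × ℚ × ℚ} (h : x ∈ ctx.PosHat) : 0 < ctx.htHat x :=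
  (posHat_iff (mem_Δhat_of_mem_PosHat h)).1 h

lemma neg_posHat_iff {x : V × ℚ × ℚ} (h : x ∈ ctx.Δhat) : -x ∈ ctx.PosHat ↔ ctx.htHat x < 0 := by
  rw [posHat_iff (neg_mem_Δhat h), map_neg, neg_pos]

lemma htHat_ne_zero {x : V × ℚ × ℚ} (h : x ∈ ctx.Δhat) : ctx.htHat x ≠ 0 := by
  obtain ⟨α, hα, k, rfl⟩ := h
  have hθ := B_ρ_pos ctx.θ_pos
  rw [htHat_apply]
  simp only
  rcases lt_trichotomy k 0 with hk | rfl | hk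
  · have h1 : (k : ℚ) ≤ -1 := by exact_mod_cast Int.le_sub_one_of_lt hk
    have := B_ρ_le hα
    nlinarith
  · rcases ctx.mem_pos_or_neg_pos α hα with h | h
    · have := B_ρ_pos h
      simpa using this.ne'
    · have := (neg_pos_iff hα).1 h
      simpa using this.ne
  · have h1 : (1 : ℚ) ≤ k := by exact_mod_cast hk
    have := neg_B_ρ_le hα
    nlinarith

lemma posHat_or_neg {x : V × ℚ × ℚ} (h : x ∈ ctx.Δhat) : x ∈ ctx.PosHat ∨ -x ∈ ctx.PosHat := by
  rw [posHat_iff h, neg_posHat_iff h]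
  exact (htHat_ne_zero h).symm.lt_or_gt

lemma neg_notMem_posHat {x : V × ℚ × ℚ} (h : x ∈ ctx.PosHat) : -x ∉ ctx.PosHat := by
  rw [neg_posHat_iff (mem_Δhat_of_mem_PosHat h)]
  exact (htHat_pos h).not_gt

lemma snd_nonneg_of_posHat {x : V × ℚ × ℚ} (h : x ∈ ctx.PosHat) : 0 ≤ x.2.1 := by
  rcases h with ⟨α, hα, rfl⟩ | ⟨α, hα, k, hk, rfl⟩
  · exact le_rfl
  · have : (1 : ℚ) ≤ k := by exact_mod_cast hk
    simp only; linarith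

lemma fst_pos_of_posHat {x : V × ℚ × ℚ} (h : x ∈ ctx.PosHat) (h0 : x.2.1 = 0) :
    x.1 ∈ ctx.Pos := by
  rcases h with ⟨α, hα, rfl⟩ | ⟨α, hα, k, hk, rfl⟩
  · exact hα
  · simp only [Int.cast_eq_zero] at h0; omega

lemma emb_mem_posHat {α : V} : ctx.emb α ∈ ctx.PosHat ↔ α ∈ ctx.Pos :=
  ⟨fun h => fst_pos_of_posHat h rfl, fun h => Or.inl ⟨α, h, rfl⟩⟩

lemma eq_emb {x : V × ℚ × ℚ} (h : x ∈ ctx.Δhat) (h0 : x.2.1 = 0) : x = ctx.emb x.1 := by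
  obtain ⟨α, hα, k, rfl⟩ := h
  simp only at h0
  simp [emb, h0]

lemma alpha0_mem_posHat : ctx.alpha0 ∈ ctx.PosHat :=
  Or.inr ⟨-ctx.θ, ctx.neg_mem_Δ _ ctx.θ_mem, 1, le_rfl, by simp [alpha0]⟩

lemma mem_posHat_of_simpleHat {x : V × ℚ × ℚ} (h : x ∈ ctx.SimpleHat) : x ∈ ctx.PosHat := by
  rcases h with ⟨α, hα, rfl⟩ | rfl
  · exact Or.inl ⟨α, hα.1, rfl⟩
  · exact alpha0_mem_posHat

lemma mem_Δhat_of_simpleHat {x : V × ℚ × ℚ} (h : x ∈ ctx.SimpleHat) : x ∈ ctx.Δhat :=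
  mem_Δhat_of_mem_PosHat (mem_posHat_of_simpleHat h)

lemma pairing_neg_right (x α : V) : ctx.pairing x (-α) = -ctx.pairing x α := by
  simp [pairing, neg_div]

lemma refl_alpha0 {x : V × ℚ × ℚ} (hx : x.2.2 = 0) :
    ctx.refl ctx.alpha0 x =
      (ctx.reflect ctx.θ x.1, x.2.1 + ctx.pairing x.1 ctx.θ, 0) := by
  rw [refl_eq rfl hx]
  simp [alpha0, reflect, pairing_neg_right]

/-- an affine simple reflection permutes the other positive affine roots -/
lemma refl_simpleHat_pos {α b : V × ℚ × ℚ} (hα : α ∈ ctx.SimpleHat) (hb : b ∈ ctx.PosHat)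
    (hne : b ≠ α) : ctx.refl α b ∈ ctx.PosHat := by
  have hbΔ := mem_Δhat_of_mem_PosHat hb
  rcases hα with ⟨a, ha, rfl⟩ | rfl
  · have haΔ := pos_mem ha.1
    rw [refl_eq rfl (snd_snd_of_mem_Δhat hbΔ)]
    rcases hb with ⟨γ, hγ, rfl⟩ | ⟨γ, hγ, k, hk, rfl⟩
    · left
      exact ⟨_, reflect_simple_pos ha hγ (by rintro rfl; exact hne rfl), by simp⟩
    · right
      exact ⟨_, reflect_mem_Δ haΔ hγ, k, hk, by simp⟩
  · rw [refl_alpha0 (snd_snd_of_mem_Δhat hbΔ)]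
    have hθ := ctx.θ_mem
    have mk : ∀ γ ∈ ctx.Δ, ∀ k : ℤ, 1 ≤ k ∨ (k = 0 ∧ γ ∈ ctx.Pos) →
        ((γ, (k : ℚ), (0 : ℚ)) : V × ℚ × ℚ) ∈ ctx.PosHat := by
      rintro γ hγ k (hk | ⟨rfl, hγ'⟩)
      · exact Or.inr ⟨γ, hγ, k, hk, rfl⟩
      · exact Or.inl ⟨γ, hγ', by simp⟩
    obtain ⟨γ, k, hγ, hk, hk0, rfl⟩ : ∃ (γ : V) (k : ℤ), γ ∈ ctx.Δ ∧ 0 ≤ k ∧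
        (k = 0 → γ ∈ ctx.Pos) ∧ b = (γ, (k : ℚ), 0) := by
      rcases hb with ⟨γ, hγ, rfl⟩ | ⟨γ, hγ, k, hk, rfl⟩
      · exact ⟨γ, 0, pos_mem hγ, le_rfl, fun _ => hγ, by simp⟩
      · exact ⟨γ, k, hγ, by omega, fun h => by omega, rfl⟩
    simp only
    by_cases h1 : γ = ctx.θ
    · rw [h1, pairing_self hθ]
      have := mk _ (reflect_mem_Δ hθ hθ) (k + 2) (Or.inl (by omega))
      simpa using this
    by_cases h2 : γ = -ctx.θ
    · subst h2
      have hk2 : 2 ≤ k := by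
        have : k ≠ 0 := fun h => ctx.pos_not_neg _ ctx.θ_pos (hk0 h)
        have : k ≠ 1 := by rintro rfl; exact hne (by simp [alpha0])
        omega
      have e : ctx.reflect ctx.θ (-ctx.θ) = ctx.θ := by
        rw [reflect, pairing_neg, pairing_self hθ]; module
      have := mk ctx.θ hθ (k - 2) (by
        by_cases h : k = 2
        · exact Or.inr ⟨by omega, ctx.θ_pos⟩
        · exact Or.inl (by omega))
      rw [e, pairing_neg, pairing_self hθ]
      simpa [sub_eq_add_neg] using this
    have hr := reflect_mem_Δ hθ hγ
    rcases pairing_long_cases hθ rfl hγ h1 h2 with h | h | h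
    · have hk1 : 1 ≤ k := by
        have : k ≠ 0 := fun h0 => by
          have := pairing_θ_nonneg (hk0 h0)
          rw [h] at this; linarith
        omega
      have hp : ctx.reflect ctx.θ γ ∈ ctx.Pos := pos_of_pairing_θ_pos hr (by
        rw [pairing_reflect _ hθ, h]; norm_num)
      have := mk _ hr (k - 1) (by
        by_cases h : k = 1
        · exact Or.inr ⟨by omega, hp⟩
        · exact Or.inl (by omega))
      rw [h]
      simpa [sub_eq_add_neg] using this
    · have e : ctx.reflect ctx.θ γ = γ := by rw [reflect, h]; module
      have := mk γ hγ k (by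
        by_cases h : k = 0
        · exact Or.inr ⟨h, hk0 h⟩
        · exact Or.inl (by omega))
      rw [e, h]
      simpa using this
    · have := mk _ hr (k + 1) (Or.inl (by omega))
      rw [h]
      simpa using this

lemma emb_mem_closure {x : V} (hx : x ∈ AddSubmonoid.closure ctx.Pos) :
    ctx.emb x ∈ AddSubmonoid.closure ctx.SimpleHat := by
  have hx' := (AddSubmonoid.closure_le.2 pos_subset_closure_simple) hx
  clear hx
  induction hx' using AddSubmonoid.closure_induction with
  | mem x hx => exact AddSubmonoid.subset_closure (Or.inl ⟨x, hx, rfl⟩)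
  | zero => exact zero_mem _
  | add x y hx hy h1 h2 =>
    have : ctx.emb (x + y) = ctx.emb x + ctx.emb y := by simp [emb]
    rw [this]
    exact add_mem h1 h2

lemma posHat_subset_closure : ctx.PosHat ⊆ AddSubmonoid.closure ctx.SimpleHat := by
  rintro x (⟨γ, hγ, rfl⟩ | ⟨γ, hγ, k, hk, rfl⟩)
  · exact emb_mem_closure (AddSubmonoid.subset_closure hγ)
  · obtain ⟨n, rfl⟩ : ∃ n : ℕ, k = n + 1 := ⟨(k - 1).toNat, by omega⟩
    have h1 : n • ctx.θ + (ctx.θ - -γ) ∈ AddSubmonoid.closure ctx.Pos :=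
      add_mem (nsmul_mem (AddSubmonoid.subset_closure ctx.θ_pos) n)
        (ctx.θ_highest _ (ctx.neg_mem_Δ γ hγ))
    have h2 : (n + 1) • ctx.alpha0 ∈ AddSubmonoid.closure ctx.SimpleHat :=
      nsmul_mem (AddSubmonoid.subset_closure (show ctx.alpha0 ∈ ctx.SimpleHat from Or.inr rfl)) _
    have e : ((γ, (((n : ℤ) + 1 : ℤ) : ℚ), 0) : V × ℚ × ℚ) =
        ctx.emb (n • ctx.θ + (ctx.θ - -γ)) + (n + 1) • ctx.alpha0 := by
      ext
      · simp only [emb, alpha0, Prod.fst_add, Prod.smul_fst]; module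
      · simp [emb, alpha0]
      · simp [emb, alpha0]
    rw [e]
    exact add_mem (emb_mem_closure h1) h2

lemma nonneg_of_simpleHat (φ : (V × ℚ × ℚ) →ₗ[ℚ] ℚ) (h : ∀ α ∈ ctx.SimpleHat, 0 ≤ φ α)
    {β : V × ℚ × ℚ} (hβ : β ∈ ctx.PosHat) : 0 ≤ φ β :=
  nonneg_of_mem_closure φ h (posHat_subset_closure hβ)

lemma finite_posHat_lt (c : ℚ) : {x | x ∈ ctx.PosHat ∧ ctx.htHat x < c}.Finite := by
  refine ((ctx.Δ_finite.prod (Set.finite_Icc (0 : ℤ) ⌈c + ctx.B ctx.ρ ctx.θ⌉)).image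
    fun p => ((p.1, (p.2 : ℚ), (0 : ℚ)) : V × ℚ × ℚ)).subset ?_
  rintro x ⟨hx, hc⟩
  have h0 := snd_nonneg_of_posHat hx
  obtain ⟨α, hα, k, rfl⟩ := mem_Δhat_of_mem_PosHat hx
  have hθ := B_ρ_pos ctx.θ_pos
  have h1 := neg_B_ρ_le hα
  rw [htHat_apply] at hc
  simp only at h0 hc
  refine ⟨(α, k), ⟨hα, by exact_mod_cast h0, ?_⟩, rfl⟩
  have h2 : (k : ℚ) ≤ c + ctx.B ctx.ρ ctx.θ := by nlinarith
  exact_mod_cast h2.trans (Int.le_ceil _)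

lemma simpleHat_refl_mem_What {α : V × ℚ × ℚ} (h : α ∈ ctx.SimpleHat) : ctx.refl α ∈ ctx.What :=
  refl_mem_What (mem_Δhat_of_simpleHat h)

/-- the affine Weyl group is generated by the simple reflections -/
lemma refl_mem_closure_simple (n : ℕ) : ∀ β ∈ ctx.PosHat,
    {x | x ∈ ctx.PosHat ∧ ctx.htHat x < ctx.htHat β}.ncard = n →
    ctx.refl β ∈ Subgroup.closure (ctx.refl '' ctx.SimpleHat) := by
  induction n using Nat.strong_induction_on with
  | _ n ih =>
    intro β hβ hn
    have hβΔ := mem_Δhat_of_mem_PosHat hβ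
    by_cases hs : β ∈ ctx.SimpleHat
    · exact Subgroup.subset_closure ⟨β, hs, rfl⟩
    obtain ⟨α, hα, hαβ⟩ : ∃ α ∈ ctx.SimpleHat, 0 < ctx.Bhat β α := by
      by_contra! hc
      have := nonneg_of_simpleHat (-ctx.Bhat β) (fun α hα => by
        simpa using hc α hα) hβ
      have h2 := Bhat_self_pos hβΔ
      rw [LinearMap.neg_apply] at this
      linarith
    have hαΔ := mem_Δhat_of_simpleHat hα
    have hβ' := refl_simpleHat_pos hα hβ (by rintro rfl; exact hs hα)
    have hlt : ctx.htHat (ctx.refl α β) < ctx.htHat β := by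
      rw [refl_apply, map_sub, map_smul, smul_eq_mul, Bhat_symm]
      have := mul_pos (div_pos (mul_pos two_pos hαβ) (Bhat_self_pos hαΔ))
        (htHat_pos (mem_posHat_of_simpleHat hα))
      linarith
    have hmem : ctx.refl α ∈ Subgroup.closure (ctx.refl '' ctx.SimpleHat) :=
      Subgroup.subset_closure ⟨α, hα, rfl⟩
    have hss : {x | x ∈ ctx.PosHat ∧ ctx.htHat x < ctx.htHat (ctx.refl α β)} ⊂
        {x | x ∈ ctx.PosHat ∧ ctx.htHat x < ctx.htHat β} :=
      ⟨fun x hx => ⟨hx.1, hx.2.trans hlt⟩, fun h => (h ⟨hβ', hlt⟩ : _ ∧ _).2.false⟩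
    have hrec := ih _ (hn ▸ Set.ncard_lt_ncard hss (finite_posHat_lt _)) _ hβ' rfl
    have hconj := conj_refl (z := ctx.refl α) (Bhat_refl_refl α) β
    have e : ctx.refl β = ctx.refl α * ctx.refl (ctx.refl α β) * ctx.refl α := by
      rw [mul_assoc, hconj, ← mul_assoc, refl_mul_self hαΔ, one_mul]
    rw [e]
    exact mul_mem (mul_mem hmem hrec) hmem

lemma What_le_closure_simple : ctx.What ≤ Subgroup.closure (ctx.refl '' ctx.SimpleHat) := by
  refine (Subgroup.closure_le _).2 ?_
  rintro _ ⟨β, hβ, rfl⟩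
  rcases posHat_or_neg hβ with h | h
  · exact refl_mem_closure_simple _ β h rfl
  · rw [← refl_neg]
    exact refl_mem_closure_simple _ _ h rfl

lemma exists_word {z : (V × ℚ × ℚ) ≃ₗ[ℚ] (V × ℚ × ℚ)} (hz : z ∈ ctx.What) :
    ∃ l : List (V × ℚ × ℚ), (∀ x ∈ l, x ∈ ctx.SimpleHat) ∧ (l.map ctx.refl).prod = z := by
  have key : ∀ x ∈ ctx.SimpleHat, ∀ y : (V × ℚ × ℚ) ≃ₗ[ℚ] (V × ℚ × ℚ),
      (∃ l : List (V × ℚ × ℚ), (∀ x ∈ l, x ∈ ctx.SimpleHat) ∧ (l.map ctx.refl).prod = y) →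
      ∃ l : List (V × ℚ × ℚ), (∀ x ∈ l, x ∈ ctx.SimpleHat) ∧
        (l.map ctx.refl).prod = ctx.refl x * y := by
    rintro x hx y ⟨l, hl, rfl⟩
    exact ⟨x :: l, by simpa [hx] using hl, by simp⟩
  have hz' := What_le_closure_simple hz
  clear hz
  induction hz' using Subgroup.closure_induction_left with
  | one => exact ⟨[], by simp, rfl⟩
  | mul_left x hx y _ h => obtain ⟨α, hα, rfl⟩ := hx; exact key α hα y h
  | inv_mul_cancel x hx y _ h =>
    obtain ⟨α, hα, rfl⟩ := hx
    rw [refl_inv (mem_Δhat_of_simpleHat hα)]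
    exact key α hα y h

lemma word_mem_What {l : List (V × ℚ × ℚ)} (hl : ∀ x ∈ l, x ∈ ctx.SimpleHat) :
    (l.map ctx.refl).prod ∈ ctx.What := by
  refine Subgroup.list_prod_mem _ fun g hg => ?_
  obtain ⟨x, hx, rfl⟩ := List.mem_map.1 hg
  exact simpleHat_refl_mem_What (hl x hx)

section Length

variable {z : (V × ℚ × ℚ) ≃ₗ[ℚ] (V × ℚ × ℚ)}

lemma posHat_or_neg_apply (hz : z ∈ ctx.What) {x : V × ℚ × ℚ} (hx : x ∈ ctx.Δhat) :
    z x ∈ ctx.PosHat ∨ -(z x) ∈ ctx.PosHat :=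
  posHat_or_neg ((mem_Δhat_What hz x).2 hx)

/-- the exchange condition -/
lemma exchange (l : List (V × ℚ × ℚ)) (hl : ∀ x ∈ l, x ∈ ctx.SimpleHat) {α : V × ℚ × ℚ}
    (hα : α ∈ ctx.SimpleHat) (hneg : -((l.map ctx.refl).prod α) ∈ ctx.PosHat) :
    ∃ l' : List (V × ℚ × ℚ), (∀ x ∈ l', x ∈ ctx.SimpleHat) ∧ l'.length + 1 = l.length ∧
      (l.map ctx.refl).prod * ctx.refl α = (l'.map ctx.refl).prod := by
  induction l with
  | nil => exact absurd hneg (neg_notMem_posHat (mem_posHat_of_simpleHat hα))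
  | cons a l ih =>
    have ha : a ∈ ctx.SimpleHat := hl a (by simp)
    have hl' : ∀ x ∈ l, x ∈ ctx.SimpleHat := fun x hx => hl x (by simp [hx])
    have hW := word_mem_What hl'
    rcases posHat_or_neg_apply hW (mem_Δhat_of_simpleHat hα) with h | h
    · have heq : (l.map ctx.refl).prod α = a := by
        by_contra hne
        refine neg_notMem_posHat (refl_simpleHat_pos ha h hne) ?_
        simpa using hneg
      have hc := conj_refl (Bhat_What hW) α
      rw [heq] at hc
      refine ⟨l, hl', rfl, ?_⟩
      rw [List.map_cons, List.prod_cons, hc, mul_assoc,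
        refl_mul_self (mem_Δhat_of_simpleHat hα), mul_one]
    · obtain ⟨l', h1, h2, h3⟩ := ih hl' h
      refine ⟨a :: l', by simpa [ha] using h1, by simp [h2], ?_⟩
      rw [List.map_cons, List.prod_cons, mul_assoc, h3, List.map_cons, List.prod_cons]

lemma word_eq_one (n : ℕ) : ∀ l : List (V × ℚ × ℚ), l.length = n →
    (∀ x ∈ l, x ∈ ctx.SimpleHat) →
    (∀ α ∈ ctx.SimpleHat, (l.map ctx.refl).prod α ∈ ctx.PosHat) →
    (l.map ctx.refl).prod = 1 := by
  induction n using Nat.strong_induction_on with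
  | _ n ih =>
    intro l hn hl hpos
    rcases List.eq_nil_or_concat' l with rfl | ⟨l, α, rfl⟩
    · rfl
    have hα : α ∈ ctx.SimpleHat := hl α (by simp)
    have e : ((l ++ [α]).map ctx.refl).prod = (l.map ctx.refl).prod * ctx.refl α := by simp
    have h1 := hpos α hα
    rw [e, LinearEquiv.mul_apply, refl_self (mem_Δhat_of_simpleHat hα), map_neg] at h1
    obtain ⟨l', h2, h3, h4⟩ := exchange l (fun x hx => hl x (by simp [hx])) hα h1
    rw [e, h4] at hpos ⊢
    simp only [List.length_append, List.length_singleton] at hn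
    exact ih l'.length (by omega) l' rfl h2 hpos

/-- only the identity of the affine Weyl group preserves the positive system -/
lemma eq_one_of_simpleHat_pos (hz : z ∈ ctx.What)
    (h : ∀ α ∈ ctx.SimpleHat, z α ∈ ctx.PosHat) : z = 1 := by
  obtain ⟨l, hl, rfl⟩ := exists_word hz
  exact word_eq_one _ l rfl hl h

lemma apply_eq_of_mem_Nhat_refl_mul {α b : V × ℚ × ℚ} (hz : z ∈ ctx.What)
    (hα : α ∈ ctx.SimpleHat) (hb : b ∈ ctx.Nhat (ctx.refl α * z)) (hb' : b ∉ ctx.Nhat z) :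
    z b = α := by
  by_contra hne
  have h1 := (posHat_or_neg_apply hz (mem_Δhat_of_mem_PosHat hb.1)).resolve_right
    fun h => hb' ⟨hb.1, h⟩
  exact neg_notMem_posHat (refl_simpleHat_pos hα h1 hne) hb.2

lemma Nhat_finite (hz : z ∈ ctx.What) : (ctx.Nhat z).Finite := by
  obtain ⟨l, hl, rfl⟩ := exists_word hz
  clear hz
  induction l with
  | nil =>
    refine Set.Finite.subset Set.finite_empty fun b hb => neg_notMem_posHat hb.1 hb.2
  | cons a l ih =>
    have hl' : ∀ x ∈ l, x ∈ ctx.SimpleHat := fun x hx => hl x (by simp [hx])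
    refine ((ih hl').union (Set.finite_singleton ((l.map ctx.refl).prod⁻¹ a))).subset ?_
    intro b hb
    by_contra hc
    rw [Set.mem_union, not_or] at hc
    rw [List.map_cons, List.prod_cons] at hb
    refine hc.2 ?_
    rw [Set.mem_singleton_iff, ← apply_eq_of_mem_Nhat_refl_mul (word_mem_What hl') (hl a (by simp))
      hb hc.1, inv_apply_apply]

lemma Nhat_refl_mul_ssubset {α : V × ℚ × ℚ} (hz : z ∈ ctx.What)
    (hα : α ∈ ctx.SimpleHat) (h : -(z⁻¹ α) ∈ ctx.PosHat) :
    ctx.Nhat (ctx.refl α * z) ⊂ ctx.Nhat z := by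
  refine (Set.ssubset_iff_of_subset fun b hb => ?_).2 ⟨-(z⁻¹ α), ⟨h, ?_⟩, fun hn => ?_⟩
  · by_contra hc
    have e := apply_eq_of_mem_Nhat_refl_mul hz hα hb hc
    rw [← e, inv_apply_apply] at h
    exact neg_notMem_posHat hb.1 h
  · rw [map_neg, apply_inv_apply, neg_neg]
    exact mem_posHat_of_simpleHat hα
  · have := hn.2
    rw [LinearEquiv.mul_apply, map_neg, apply_inv_apply, map_neg,
      refl_self (mem_Δhat_of_simpleHat hα), neg_neg] at this
    exact neg_notMem_posHat (mem_posHat_of_simpleHat hα) this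

/-- right multiplication by the reflection in an inverted positive root decreases the length -/
lemma ncard_Nhat_mul_refl_lt {α : V × ℚ × ℚ} (hz : z ∈ ctx.What) (hα : α ∈ ctx.Nhat z) :
    (ctx.Nhat (z * ctx.refl α)).ncard < (ctx.Nhat z).ncard := by
  classical
  have hfin := Nhat_finite hz
  have hαΔ := mem_Δhat_of_mem_PosHat hα.1
  refine lt_of_le_of_lt ?_ (Set.ncard_sdiff_singleton_lt_of_mem hα hfin)
  refine Set.ncard_le_ncard_of_injOn
    (fun γ => if ctx.refl α γ ∈ ctx.PosHat then ctx.refl α γ else γ) ?_ ?_ hfin.sdiff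
  · intro γ hγ
    have hγΔ := mem_Δhat_of_mem_PosHat hγ.1
    by_cases h : ctx.refl α γ ∈ ctx.PosHat
    · simp only [h, if_true]
      refine ⟨⟨h, hγ.2⟩, fun he => ?_⟩
      have e : γ = -α := by
        rw [← refl_refl hαΔ γ, Set.mem_singleton_iff.1 he, refl_self hαΔ]
      exact neg_notMem_posHat hα.1 (e ▸ hγ.1)
    · simp only [h, if_false]
      have h1 := htHat_pos hα.1
      have h2 := htHat_pos hγ.1
      have h3 := (neg_posHat_iff ((mem_Δhat_What hz α).2 hαΔ)).1 hα.2
      have h4 := (neg_posHat_iff ((mem_Δhat_What hz _).2 (refl_mem_Δhat hαΔ hγΔ))).1 hγ.2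
      have h5 := (neg_posHat_iff (refl_mem_Δhat hαΔ hγΔ)).1
        ((posHat_or_neg (refl_mem_Δhat hαΔ hγΔ)).resolve_left h)
      rw [refl_apply, map_sub, map_smul, smul_eq_mul] at h5
      rw [refl_apply, map_sub, map_smul, map_sub, map_smul, smul_eq_mul] at h4
      refine ⟨⟨hγ.1, (neg_posHat_iff ((mem_Δhat_What hz γ).2 hγΔ)).2 ?_⟩, fun he => ?_⟩
      · by_contra! hc
        have hm : 0 < 2 * ctx.Bhat α γ / ctx.Bhat α α := by
          by_contra! hm
          nlinarith
        nlinarith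
      · have := hγ.2
        rw [Set.mem_singleton_iff.1 he, LinearEquiv.mul_apply, refl_self hαΔ, map_neg,
          neg_neg] at this
        exact neg_notMem_posHat this hα.2
  · intro γ hγ γ' hγ' he
    simp only at he
    split_ifs at he with h h' h'
    · exact (ctx.refl α).injective he
    · rw [← he, refl_refl hαΔ] at h'
      exact absurd hγ.1 h'
    · rw [he, refl_refl hαΔ] at h
      exact absurd hγ'.1 h
    · exact he

lemma mem_Wfin_of_Nhat (n : ℕ) : ∀ z ∈ ctx.What, (ctx.Nhat z).ncard = n →
    (∀ b ∈ ctx.Nhat z, b.2.1 = 0) → z ∈ ctx.Wfin := by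
  induction n using Nat.strong_induction_on with
  | _ n ih =>
    intro z hz hn h0
    by_cases h : ∀ α ∈ ctx.SimpleHat, z α ∈ ctx.PosHat
    · rw [eq_one_of_simpleHat_pos hz h]
      exact one_mem _
    push Not at h
    obtain ⟨α, hα, hneg⟩ := h
    have hαΔ := mem_Δhat_of_simpleHat hα
    have hN : α ∈ ctx.Nhat z :=
      ⟨mem_posHat_of_simpleHat hα, (posHat_or_neg_apply hz hαΔ).resolve_left hneg⟩
    have hlev := h0 α hN
    have hW : ctx.refl α ∈ ctx.Wfin := by
      rw [eq_emb hαΔ hlev]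
      exact refl_emb_mem_Wfin (fst_mem_of_mem_Δhat hαΔ)
    have hmem : z * ctx.refl α ∈ ctx.Wfin := by
      refine ih _ (hn ▸ ncard_Nhat_mul_refl_lt hz hN) _
        (mul_mem hz (refl_mem_What hαΔ)) rfl fun b hb => ?_
      have hne : b ≠ α := by
        rintro rfl
        have := hb.2
        rw [LinearEquiv.mul_apply, refl_self hαΔ, map_neg, neg_neg] at this
        exact neg_notMem_posHat this hN.2
      rw [← snd_Wfin hW]
      exact h0 _ ⟨refl_simpleHat_pos hα hb.1 hne, hb.2⟩
    have := mul_mem hmem hW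
    rwa [mul_assoc, refl_mul_self hαΔ, mul_one] at this

/-- the roots of positive level orthogonal to `α₀` can be removed from `N̂(z)` by left
multiplication with simple reflections fixing `z(α₀)` -/
lemma exists_mem_Wfin_of_Nhat (n : ℕ) : ∀ z ∈ ctx.What, (ctx.Nhat z).ncard = n →
    (∀ b ∈ ctx.Nhat z, b.2.1 = 0 ∨ ctx.Bhat b ctx.alpha0 = 0) →
    ∃ z' ∈ ctx.Wfin, z' ctx.alpha0 = z ctx.alpha0 ∧ ctx.Nhat z' ⊆ ctx.Nhat z := by
  induction n using Nat.strong_induction_on with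
  | _ n ih =>
    intro z hz hn h0
    by_cases h : ∀ b ∈ ctx.Nhat z, b.2.1 = 0
    · exact ⟨z, mem_Wfin_of_Nhat _ z hz rfl h, rfl, subset_rfl⟩
    push Not at h
    obtain ⟨e, he, hlev⟩ := h
    have hlev' : 0 < e.2.1 := lt_of_le_of_ne (snd_nonneg_of_posHat he.1) (Ne.symm hlev)
    obtain ⟨α, hα, hαlev⟩ : ∃ α ∈ ctx.SimpleHat, (z⁻¹ α).2.1 < 0 := by
      by_contra! hc
      have := nonneg_of_simpleHat (((LinearMap.fst ℚ ℚ ℚ).comp (LinearMap.snd ℚ V (ℚ × ℚ))).comp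
        (z⁻¹ : (V × ℚ × ℚ) ≃ₗ[ℚ] (V × ℚ × ℚ)).toLinearMap) hc he.2
      simp only [LinearMap.comp_apply, LinearEquiv.coe_coe, map_neg, inv_apply_apply,
        LinearMap.snd_apply, LinearMap.fst_apply] at this
      linarith
    have hαΔ := mem_Δhat_of_simpleHat hα
    have hpos : -(z⁻¹ α) ∈ ctx.PosHat :=
      (posHat_or_neg_apply (inv_mem hz) hαΔ).resolve_left fun h =>
        hαlev.not_ge (snd_nonneg_of_posHat h)
    have hN : -(z⁻¹ α) ∈ ctx.Nhat z := by
      refine ⟨hpos, ?_⟩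
      rw [map_neg, apply_inv_apply, neg_neg]
      exact mem_posHat_of_simpleHat hα
    have horth : ctx.Bhat α (z ctx.alpha0) = 0 := by
      rcases h0 _ hN with h | h
      · simp only [Prod.snd_neg, Prod.fst_neg] at h; linarith
      · rw [← Bhat_What hz, map_neg, apply_inv_apply, map_neg, LinearMap.neg_apply] at h
        linarith
    have hss := Nhat_refl_mul_ssubset hz hα hpos
    obtain ⟨z', h1, h2, h3⟩ := ih _ (hn ▸ Set.ncard_lt_ncard hss (Nhat_finite hz)) _
      (mul_mem (refl_mem_What hαΔ) hz) rfl (fun b hb => h0 b (hss.1 hb))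
    refine ⟨z', h1, ?_, h3.trans hss.1⟩
    rw [h2, LinearEquiv.mul_apply, refl_apply, horth]
    simp

lemma Nhat_eq_image_Nfin (hz : z ∈ ctx.Wfin) : ctx.Nhat z = ctx.emb '' ctx.Nfin z := by
  ext b
  constructor
  · intro hb
    have h1 := snd_nonneg_of_posHat hb.1
    have h2 := snd_nonneg_of_posHat hb.2
    simp only [Prod.snd_neg, Prod.fst_neg, snd_Wfin hz] at h2
    have h3 : b.2.1 = 0 := by linarith
    have e := eq_emb (mem_Δhat_of_mem_PosHat hb.1) h3
    exact ⟨b.1, ⟨fst_pos_of_posHat hb.1 h3, e ▸ hb.2⟩, e.symm⟩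
  · rintro ⟨γ, hγ, rfl⟩
    exact ⟨emb_mem_posHat.2 hγ.1, hγ.2⟩

lemma emb_injective : Function.Injective ctx.emb := fun _ _ h => congrArg Prod.fst h

lemma lenFin_eq (hz : z ∈ ctx.Wfin) : ctx.lenFin z = (ctx.Nhat z).ncard := by
  rw [Nhat_eq_image_Nfin hz, Set.ncard_image_of_injective _ emb_injective, lenFin]

lemma Bhat_emb (x y : V) : ctx.Bhat (ctx.emb x) (ctx.emb y) = ctx.B x y := by
  simp [Bhat_apply, emb]

lemma apply_emb_mem (hz : z ∈ ctx.Wfin) {α : V} (hα : α ∈ ctx.Δ) :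
    z (ctx.emb α) = ctx.emb (z (ctx.emb α)).1 ∧ (z (ctx.emb α)).1 ∈ ctx.Δ := by
  have h := (mem_Δhat_What (Wfin_le_What hz) _).2 (emb_mem_Δhat hα)
  exact ⟨eq_emb h (by rw [snd_Wfin hz]; rfl), fst_mem_of_mem_Δhat h⟩

/-- an element of `W` is determined by its value at `θ` when it keeps all positive roots
orthogonal to `θ` positive -/
lemma eq_of_apply_θ {u : (V × ℚ × ℚ) ≃ₗ[ℚ] (V × ℚ × ℚ)} (hu : u ∈ ctx.Wfin) (hz : z ∈ ctx.Wfin)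
    (hθ : u (ctx.emb ctx.θ) = z (ctx.emb ctx.θ))
    (hu0 : ∀ α ∈ ctx.Pos, ctx.B α ctx.θ = 0 → u (ctx.emb α) ∈ ctx.PosHat)
    (hz0 : ∀ α ∈ ctx.Pos, ctx.B α ctx.θ = 0 → z (ctx.emb α) ∈ ctx.PosHat) : u = z := by
  have ht : u⁻¹ * z ∈ ctx.Wfin := mul_mem (inv_mem hu) hz
  have htW := Wfin_le_What ht
  have htθ : (u⁻¹ * z) (ctx.emb ctx.θ) = ctx.emb ctx.θ := by
    rw [LinearEquiv.mul_apply, ← hθ, inv_apply_apply]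
  refine inv_mul_eq_one.1 (eq_one_of_simpleHat_pos htW ?_)
  rintro _ (⟨α, hα, rfl⟩ | rfl)
  · change (u⁻¹ * z) (ctx.emb α) ∈ ctx.PosHat
    have hB : ctx.B ((u⁻¹ * z) (ctx.emb α)).1 ctx.θ = ctx.B α ctx.θ := by
      rw [← Bhat_emb, ← Bhat_emb, ← (apply_emb_mem ht (pos_mem hα.1)).1,
        ← Bhat_What htW (ctx.emb α), htθ]
    obtain ⟨he, hm⟩ := apply_emb_mem ht (pos_mem hα.1)
    rw [he, emb_mem_posHat]
    rcases (B_θ_nonneg hα.1).lt_or_eq with h | h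
    · refine pos_of_pairing_θ_pos hm ?_
      rw [pairing, hB, ctx.B_symm α]
      exact div_pos (mul_pos two_pos h) (B_self_pos ctx.θ_mem)
    · refine (ctx.mem_pos_or_neg_pos _ hm).resolve_right fun hn => ?_
      have h0 : ctx.B α ctx.θ = 0 := by rw [ctx.B_symm, ← h]
      have h1 := hu0 _ hn (by rw [map_neg, LinearMap.neg_apply, hB, h0, neg_zero])
      have h2 : ctx.emb (-((u⁻¹ * z) (ctx.emb α)).1) = -((u⁻¹ * z) (ctx.emb α)) := by
        conv_rhs => rw [he]
        simp [emb]
      rw [h2, map_neg, LinearEquiv.mul_apply, apply_inv_apply] at h1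
      exact neg_notMem_posHat (hz0 α hα.1 h0) h1
  · rw [alpha0_eq, map_sub, What_δhat htW, htθ, ← alpha0_eq]
    exact alpha0_mem_posHat

end Length

end Affine

section Minimal

variable {ctx} {μ : V} {u : (V × ℚ × ℚ) ≃ₗ[ℚ] (V × ℚ × ℚ)}

lemma refl_alpha0_emb (v : V) :
    ctx.refl ctx.alpha0 (ctx.emb v) = (ctx.reflect ctx.θ v, ctx.pairing v ctx.θ, 0) := by
  rw [refl_alpha0 rfl]; simp [emb]

lemma refl_alpha0_sub_emb (v : V) : ctx.refl ctx.alpha0 (ctx.δhat - ctx.emb v) =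
    (-ctx.reflect ctx.θ v, 1 - ctx.pairing v ctx.θ, 0) := by
  rw [map_sub, refl_δhat (alpha0_mem_Δhat ctx), refl_alpha0_emb]
  simp [δhat]

lemma δhat_sub_emb_mem_posHat {v : V} (hv : v ∈ ctx.Δ) : ctx.δhat - ctx.emb v ∈ ctx.PosHat :=
  Or.inr ⟨-v, ctx.neg_mem_Δ v hv, 1, le_rfl, by simp [δhat, emb]⟩

lemma apply_emb_mem_posHat (hu : u ∈ ctx.Wfin) (huθ : u (ctx.emb ctx.θ) = ctx.emb μ)
    (hmin : ∀ v ∈ ctx.Wfin, v (ctx.emb ctx.θ) = ctx.emb μ → ctx.lenFin u ≤ ctx.lenFin v)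
    {α : V} (hα : α ∈ ctx.Pos) (h0 : ctx.B α ctx.θ = 0) : u (ctx.emb α) ∈ ctx.PosHat := by
  by_contra hc
  have hαh := emb_mem_Δhat (pos_mem hα)
  have hN : ctx.emb α ∈ ctx.Nhat u := ⟨emb_mem_posHat.2 hα,
    (posHat_or_neg_apply (Wfin_le_What hu) hαh).resolve_left hc⟩
  have hW := mul_mem hu (refl_emb_mem_Wfin (pos_mem hα))
  have hle := hmin _ hW (by
    rw [LinearEquiv.mul_apply, refl_apply, Bhat_emb, h0]
    simpa using huθ)
  rw [lenFin_eq hu, lenFin_eq hW] at hle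
  exact hle.not_gt (ncard_Nhat_mul_refl_lt (Wfin_le_What hu) hN)

lemma mem_Nhat_mul_iff {b : V × ℚ × ℚ} (hb : b ∈ ctx.PosHat) (hne : b ≠ ctx.alpha0) :
    b ∈ ctx.Nhat (u * ctx.refl ctx.alpha0) ↔ ctx.refl ctx.alpha0 b ∈ ctx.Nhat u :=
  ⟨fun h => ⟨refl_simpleHat_pos (Or.inr rfl) hb hne, h.2⟩, fun h => ⟨hb, h.2⟩⟩

lemma mul_refl_alpha0_apply (hu : u ∈ ctx.Wfin) (huθ : u (ctx.emb ctx.θ) = ctx.emb μ) :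
    (u * ctx.refl ctx.alpha0) ctx.alpha0 = ctx.emb μ - ctx.δhat := by
  rw [LinearEquiv.mul_apply, refl_self (alpha0_mem_Δhat ctx), alpha0_eq, map_neg, map_sub,
    What_δhat (Wfin_le_What hu), huθ, neg_sub]

/-- a positive root inverted by `u` has inner product `1` with `θ∨` -/
lemma pairing_eq_one_of_mem_Nhat (hμ : μ ∈ ctx.Pos)
    (huθ : u (ctx.emb ctx.θ) = ctx.emb μ)
    (hu0 : ∀ α ∈ ctx.Pos, ctx.B α ctx.θ = 0 → u (ctx.emb α) ∈ ctx.PosHat)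
    {v : V} (hv : ctx.emb v ∈ ctx.Nhat u) : v ∈ ctx.Pos ∧ ctx.pairing v ctx.θ = 1 := by
  have hp := emb_mem_posHat.1 hv.1
  refine ⟨hp, ?_⟩
  have h1 : v ≠ ctx.θ := by
    rintro rfl
    have := hv.2
    rw [huθ] at this
    exact neg_notMem_posHat (emb_mem_posHat.2 hμ) this
  have h2 : v ≠ -ctx.θ := by
    rintro rfl
    exact ctx.pos_not_neg _ ctx.θ_pos hp
  have h3 := pairing_θ_nonneg hp
  rcases pairing_long_cases ctx.θ_mem rfl (pos_mem hp) h1 h2 with h | h | h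
  · linarith
  · have h4 := pairing_mul v ctx.θ_mem
    rw [h] at h4
    exact absurd hv.2 (neg_notMem_posHat (hu0 v hp (by linarith)))
  · exact h

lemma eq_δhat_sub_emb_of_mem_Nhat (hu : u ∈ ctx.Wfin) (hμ : μ ∈ ctx.Pos)
    (huθ : u (ctx.emb ctx.θ) = ctx.emb μ)
    (hu0 : ∀ α ∈ ctx.Pos, ctx.B α ctx.θ = 0 → u (ctx.emb α) ∈ ctx.PosHat)
    {b : V × ℚ × ℚ} (hb : b ∈ ctx.Nhat (u * ctx.refl ctx.alpha0)) :
    ∃ γ ∈ ctx.Pos, 0 < ctx.pairing γ ctx.θ ∧ b = ctx.δhat - ctx.emb γ := by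
  by_cases hne : b = ctx.alpha0
  · exact ⟨ctx.θ, ctx.θ_pos, by rw [pairing_self ctx.θ_mem]; norm_num, by rw [hne, alpha0_eq]⟩
  have h1 := (mem_Nhat_mul_iff hb.1 hne).1 hb
  rw [Nhat_eq_image_Nfin hu] at h1
  obtain ⟨v, hv, he⟩ := h1
  obtain ⟨hp, h1⟩ := pairing_eq_one_of_mem_Nhat hμ huθ hu0
    (⟨emb_mem_posHat.2 hv.1, hv.2⟩ : ctx.emb v ∈ ctx.Nhat u)
  have hb' : b = (ctx.reflect ctx.θ v, 1, 0) := by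
    rw [← refl_refl (alpha0_mem_Δhat ctx) b, ← he, refl_alpha0_emb, h1]
  have hm := ctx.neg_mem_Δ _ (reflect_mem_Δ ctx.θ_mem (pos_mem hp))
  have hpair : 0 < ctx.pairing (-ctx.reflect ctx.θ v) ctx.θ := by
    rw [pairing_neg, pairing_reflect _ ctx.θ_mem, neg_neg, h1]
    exact one_pos
  exact ⟨_, pos_of_pairing_θ_pos hm hpair, hpair, by rw [hb']; simp [δhat, emb]⟩

/-- the ideal of `u * s₀` is contained in every ideal with the same rootlet -/
lemma idealOf_subset (hu : u ∈ ctx.Wfin) (hμ : μ ∈ ctx.Pos)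
    (huθ : u (ctx.emb ctx.θ) = ctx.emb μ)
    (hu0 : ∀ α ∈ ctx.Pos, ctx.B α ctx.θ = 0 → u (ctx.emb α) ∈ ctx.PosHat)
    {w : (V × ℚ × ℚ) ≃ₗ[ℚ] (V × ℚ × ℚ)} (hw : ctx.IsMinuscule w)
    (hwμ : w ctx.alpha0 + ctx.δhat = ctx.emb μ) :
    ctx.idealOf (u * ctx.refl ctx.alpha0) ⊆ ctx.idealOf w := by
  obtain ⟨hwW, hwN⟩ := hw
  have h0Δ := alpha0_mem_Δhat ctx
  have hwα : -(w ctx.alpha0) = ctx.δhat - ctx.emb μ := by rw [← hwμ]; abel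
  have hwpos : -(w ctx.alpha0) ∈ ctx.PosHat := hwα ▸ δhat_sub_emb_mem_posHat (pos_mem hμ)
  set z := w * ctx.refl ctx.alpha0 with hz
  have hzα : z ctx.alpha0 = ctx.δhat - ctx.emb μ := by
    rw [hz, LinearEquiv.mul_apply, refl_self h0Δ, map_neg, hwα]
  have hzW : z ∈ ctx.What := mul_mem hwW (refl_mem_What h0Δ)
  have hzN : ∀ b ∈ ctx.Nhat z, b.2.1 = 0 ∧ ctx.pairing b.1 ctx.θ = 1 ∨
      b.2.1 = 1 ∧ ctx.pairing b.1 ctx.θ = 0 := by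
    intro b hb
    have hne : b ≠ ctx.alpha0 := by
      rintro rfl
      refine neg_notMem_posHat ?_ hb.2
      rw [hzα]
      exact δhat_sub_emb_mem_posHat (pos_mem hμ)
    obtain ⟨γ, hγ, he⟩ := hwN _ ((mem_Nhat_mul_iff hb.1 hne).1 hb)
    have hbe : b = (-ctx.reflect ctx.θ γ, 1 - ctx.pairing γ ctx.θ, 0) := by
      rw [← refl_refl h0Δ b, he, refl_alpha0_sub_emb]
    have h1 := snd_nonneg_of_posHat hb.1
    have h2 := pairing_θ_nonneg hγ
    rw [hbe] at h1 ⊢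
    simp only at h1 ⊢
    rw [pairing_neg, pairing_reflect _ ctx.θ_mem, neg_neg]
    have hγθ : γ ≠ ctx.θ := by
      rintro rfl
      rw [pairing_self ctx.θ_mem] at h1
      linarith
    have hγθ' : γ ≠ -ctx.θ := by
      rintro rfl
      exact ctx.pos_not_neg _ ctx.θ_pos hγ
    rcases pairing_long_cases ctx.θ_mem rfl (pos_mem hγ) hγθ hγθ' with h | h | h
    · linarith
    · exact Or.inr ⟨by rw [h]; ring, h⟩
    · exact Or.inl ⟨by rw [h]; ring, h⟩
  obtain ⟨z', hz'W, hz'α, hz'N⟩ := exists_mem_Wfin_of_Nhat _ z hzW rfl (by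
    intro b hb
    refine (hzN b hb).imp And.left fun h => ?_
    have h1 := pairing_mul b.1 ctx.θ_mem
    rw [h.2] at h1
    rw [Bhat_apply, snd_snd_of_mem_Δhat (mem_Δhat_of_mem_PosHat hb.1)]
    simp only [alpha0, map_neg]
    linarith)
  have hz'θ : z' (ctx.emb ctx.θ) = ctx.emb μ := by
    rw [hzα, alpha0_eq, map_sub, What_δhat (Wfin_le_What hz'W)] at hz'α
    exact sub_right_inj.1 hz'α
  have huz : u = z' := eq_of_apply_θ hu hz'W (huθ.trans hz'θ.symm) hu0 fun α hα h0 => by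
    have hαh := emb_mem_Δhat (pos_mem hα)
    refine (posHat_or_neg_apply (Wfin_le_What hz'W) hαh).resolve_right fun hn => ?_
    rcases hzN _ (hz'N ⟨emb_mem_posHat.2 hα, hn⟩) with h | h
    · have h1 := h.2
      simp [emb, pairing, h0] at h1
    · have h1 := h.1
      simp [emb] at h1
  rintro γ ⟨hγ, hb⟩
  refine ⟨hγ, hb.1, ?_⟩
  by_cases hne : ctx.δhat - ctx.emb γ = ctx.alpha0
  · rwa [hne]
  · have h1 := (hz'N (huz ▸ (mem_Nhat_mul_iff hb.1 hne).1 hb)).2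
    rwa [hz, LinearEquiv.mul_apply, refl_refl h0Δ] at h1

end Minimal

section Count

variable {ctx} {μ : V} {u : (V × ℚ × ℚ) ≃ₗ[ℚ] (V × ℚ × ℚ)}

lemma B_ρ_coroot (μ : V) :
    ctx.B ctx.ρ (ctx.coroot μ) * 2 = ∑ γ ∈ ctx.pos_finite.toFinset, ctx.pairing γ μ := by
  rw [mul_comm, two_B_ρ]
  refine Finset.sum_congr rfl fun γ _ => ?_
  rw [coroot, map_smul, smul_eq_mul, pairing]
  ring

/-- the value `2(ρ, μ∨)` for a long positive root `μ` -/
lemma B_ρ_coroot_of_long (hμ : μ ∈ ctx.PosLong) :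
    ctx.B ctx.ρ (ctx.coroot μ) * 2 = 2 + ({η | η ∈ ctx.Pos ∧ ctx.pairing η μ = 1}.ncard : ℚ)
      - ({η | η ∈ ctx.Pos ∧ ctx.pairing η μ = -1}.ncard : ℚ) := by
  classical
  have hμΔ := pos_mem hμ.1
  have hcard : ∀ c : ℚ, ({η | η ∈ ctx.Pos ∧ ctx.pairing η μ = c}.ncard : ℚ) =
      ∑ γ ∈ ctx.pos_finite.toFinset, if ctx.pairing γ μ = c then 1 else 0 := by
    intro c
    rw [Finset.sum_boole, ← Set.ncard_coe_finset]
    congr 2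
    ext η
    simp
  have htwo : ∑ γ ∈ ctx.pos_finite.toFinset, (if γ = μ then (2 : ℚ) else 0) = 2 := by
    rw [Finset.sum_ite_eq']
    simp [hμ.1]
  rw [B_ρ_coroot, hcard, hcard, ← htwo, ← Finset.sum_add_distrib, ← Finset.sum_sub_distrib]
  refine Finset.sum_congr rfl fun γ hγ => ?_
  have hγ' : γ ∈ ctx.Pos := by simpa using hγ
  by_cases h1 : γ = μ
  · rw [h1, pairing_self hμΔ]; norm_num
  have h2 : γ ≠ -μ := by
    rintro rfl
    exact ctx.pos_not_neg _ hμ.1 hγ'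
  rcases pairing_long_cases hμΔ hμ.2 (pos_mem hγ') h1 h2 with h | h | h <;> rw [h] <;>
    simp [h1] <;> norm_num

lemma ncard_pairing_eq_one (μ : V) :
    {η | η ∈ ctx.Δ ∧ ctx.pairing η μ = 1}.ncard = {η | η ∈ ctx.Pos ∧ ctx.pairing η μ = 1}.ncard
      + {η | η ∈ ctx.Pos ∧ ctx.pairing η μ = -1}.ncard := by
  have hfin : ∀ c : ℚ, {η | η ∈ ctx.Pos ∧ ctx.pairing η μ = c}.Finite := fun c =>
    ctx.pos_finite.subset fun _ h => h.1
  rw [← Set.ncard_image_of_injective {η | η ∈ ctx.Pos ∧ ctx.pairing η μ = -1} neg_injective,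
    ← Set.ncard_union_eq ?_ (hfin 1) ((hfin (-1)).image _)]
  · congr 1
    ext η
    simp only [Set.mem_ofPred_eq, Set.mem_union, Set.mem_image]
    constructor
    · rintro ⟨h, h1⟩
      exact (ctx.mem_pos_or_neg_pos η h).imp (fun h => ⟨h, h1⟩)
        fun h => ⟨-η, ⟨h, by rw [pairing_neg, h1]⟩, neg_neg η⟩
    · rintro (⟨h, h1⟩ | ⟨η, ⟨h, h1⟩, rfl⟩)
      · exact ⟨pos_mem h, h1⟩
      · exact ⟨ctx.neg_mem_Δ _ (pos_mem h), by rw [pairing_neg, h1, neg_neg]⟩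
  · rw [Set.disjoint_left]
    rintro _ h ⟨η, h', rfl⟩
    exact ctx.pos_not_neg _ h'.1 h.1

lemma pairing_apply (hu : u ∈ ctx.Wfin) (huθ : u (ctx.emb ctx.θ) = ctx.emb μ) {α : V}
    (hα : α ∈ ctx.Δ) : ctx.pairing (u (ctx.emb α)).1 μ = ctx.pairing α ctx.θ := by
  rw [pairing, pairing, ← Bhat_emb, ← Bhat_emb, ← Bhat_emb α, ← Bhat_emb ctx.θ,
    ← (apply_emb_mem hu hα).1, ← huθ, Bhat_What (Wfin_le_What hu), Bhat_What (Wfin_le_What hu)]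

lemma pairing_inv_apply (hu : u ∈ ctx.Wfin) (huθ : u (ctx.emb ctx.θ) = ctx.emb μ) {η : V}
    (hη : η ∈ ctx.Δ) : ctx.pairing (u⁻¹ (ctx.emb η)).1 ctx.θ = ctx.pairing η μ := by
  obtain ⟨h1, h2⟩ := apply_emb_mem (inv_mem hu) hη
  rw [← pairing_apply hu huθ h2, ← h1, apply_inv_apply]
  rfl

lemma injOn_apply (hu : u ∈ ctx.Wfin) : Set.InjOn (fun α => (u (ctx.emb α)).1) ctx.Δ := by
  intro α hα β hβ h
  simp only at h
  refine emb_injective (ctx := ctx) (u.injective ?_)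
  rw [(apply_emb_mem hu hα).1, (apply_emb_mem hu hβ).1, h]

lemma ncard_pairing_θ (hu : u ∈ ctx.Wfin) (huθ : u (ctx.emb ctx.θ) = ctx.emb μ) :
    {η | η ∈ ctx.Δ ∧ ctx.pairing η ctx.θ = 1}.ncard =
      {η | η ∈ ctx.Δ ∧ ctx.pairing η μ = 1}.ncard := by
  rw [← ((injOn_apply hu).mono fun _ h => h.1).ncard_image]
  congr 1
  ext η
  constructor
  · rintro ⟨α, ⟨hα, h1⟩, rfl⟩
    exact ⟨(apply_emb_mem hu hα).2, by rw [pairing_apply hu huθ hα, h1]⟩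
  · rintro ⟨hη, h1⟩
    obtain ⟨h2, h3⟩ := apply_emb_mem (inv_mem hu) hη
    refine ⟨_, ⟨h3, by rw [pairing_inv_apply hu huθ hη, h1]⟩, ?_⟩
    simp only
    rw [← h2, apply_inv_apply]
    rfl

lemma B_ρ_coroot_sub (hμ : μ ∈ ctx.PosLong) (hu : u ∈ ctx.Wfin)
    (huθ : u (ctx.emb ctx.θ) = ctx.emb μ) :
    ctx.B ctx.ρ (ctx.coroot ctx.θ - ctx.coroot μ) =
      ({η | η ∈ ctx.Pos ∧ ctx.pairing η μ = -1}.ncard : ℚ) := by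
  have h1 := B_ρ_coroot_of_long hμ
  have h2 := B_ρ_coroot_of_long (ctx := ctx) ⟨ctx.θ_pos, rfl⟩
  have h3 := ncard_pairing_θ hu huθ
  rw [ncard_pairing_eq_one, ncard_pairing_eq_one] at h3
  have h4 : {η | η ∈ ctx.Pos ∧ ctx.pairing η ctx.θ = -1} = ∅ := by
    refine Set.eq_empty_of_forall_notMem fun η h => ?_
    have := pairing_θ_nonneg h.1
    rw [h.2] at this
    linarith
  rw [h4, Set.ncard_empty, add_zero] at h3
  rw [h4, Set.ncard_empty, h3] at h2
  push_cast at h2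
  rw [map_sub]
  linarith

lemma idealOf_eq (hu : u ∈ ctx.Wfin) (hμ : μ ∈ ctx.Pos)
    (huθ : u (ctx.emb ctx.θ) = ctx.emb μ)
    (hu0 : ∀ α ∈ ctx.Pos, ctx.B α ctx.θ = 0 → u (ctx.emb α) ∈ ctx.PosHat) :
    ctx.idealOf (u * ctx.refl ctx.alpha0) = insert ctx.θ
      ((fun η => (u⁻¹ (ctx.emb η)).1 + ctx.θ) '' {η | η ∈ ctx.Pos ∧ ctx.pairing η μ = -1}) := by
  ext γ
  rw [Set.mem_insert_iff]
  constructor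
  · rintro ⟨hγ, hb⟩
    refine or_iff_not_imp_left.2 fun hne => ?_
    have hne' : ctx.δhat - ctx.emb γ ≠ ctx.alpha0 := by
      rw [alpha0_eq]
      exact fun h => hne (emb_injective (sub_right_inj.1 h))
    have h1 := (mem_Nhat_mul_iff hb.1 hne').1 hb
    obtain ⟨v, hv, he⟩ := Nhat_eq_image_Nfin hu ▸ h1
    rw [← he] at h1
    obtain ⟨hvp, hv1⟩ := pairing_eq_one_of_mem_Nhat hμ huθ hu0 h1
    have he' := congrArg Prod.fst he
    have he2 := congrArg (fun x : V × ℚ × ℚ => x.2.1) he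
    rw [refl_alpha0_sub_emb] at he' he2
    simp only [emb, reflect] at he' he2
    have hvγ : v = ctx.θ - γ := by
      rw [he', show ctx.pairing γ ctx.θ = 1 by linarith]; module
    obtain ⟨h2, h3⟩ := apply_emb_mem hu (pos_mem hvp)
    have h4 : ctx.emb (-(u (ctx.emb v)).1) = -u (ctx.emb v) := by
      conv_rhs => rw [h2]
      simp [emb]
    refine ⟨-(u (ctx.emb v)).1, ⟨emb_mem_posHat.1 (h4 ▸ h1.2), ?_⟩, ?_⟩
    · rw [pairing_neg, pairing_apply hu huθ (pos_mem hvp), hv1]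
    · simp only
      rw [h4, map_neg, inv_apply_apply, hvγ]
      simp [emb]
  · rintro (rfl | ⟨η, ⟨hη, h1⟩, rfl⟩)
    · refine ⟨ctx.θ_pos, ?_⟩
      rw [← alpha0_eq]
      refine ⟨alpha0_mem_posHat, ?_⟩
      rw [mul_refl_alpha0_apply hu huθ, neg_sub]
      exact δhat_sub_emb_mem_posHat (pos_mem hμ)
    · obtain ⟨h2, h3⟩ := apply_emb_mem (inv_mem hu) (pos_mem hη)
      have h4 := pairing_inv_apply hu huθ (pos_mem hη)
      rw [h1] at h4
      set v := (u⁻¹ (ctx.emb η)).1 with hv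
      have h5 : ctx.reflect ctx.θ v = v + ctx.θ := by
        rw [reflect, h4]; module
      have h6 : v + ctx.θ ∈ ctx.Δ := h5 ▸ reflect_mem_Δ ctx.θ_mem h3
      have h7 : ctx.pairing (v + ctx.θ) ctx.θ = 1 := by
        rw [pairing_add, h4, pairing_self ctx.θ_mem]; norm_num
      simp only
      refine ⟨pos_of_pairing_θ_pos h6 (by rw [h7]; exact one_pos),
        δhat_sub_emb_mem_posHat h6, ?_⟩
      have h8 : ctx.refl ctx.alpha0 (ctx.δhat - ctx.emb (v + ctx.θ)) = -ctx.emb v := by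
        rw [refl_alpha0_sub_emb, h7, ← h5, reflect_reflect _ ctx.θ_mem]
        simp [emb]
      rw [LinearEquiv.mul_apply, h8, map_neg, neg_neg, ← h2, apply_inv_apply]
      exact emb_mem_posHat.2 hη

lemma ncard_idealOf (hu : u ∈ ctx.Wfin) (hμ : μ ∈ ctx.Pos)
    (huθ : u (ctx.emb ctx.θ) = ctx.emb μ)
    (hu0 : ∀ α ∈ ctx.Pos, ctx.B α ctx.θ = 0 → u (ctx.emb α) ∈ ctx.PosHat) :
    (ctx.idealOf (u * ctx.refl ctx.alpha0)).ncard =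
      {η | η ∈ ctx.Pos ∧ ctx.pairing η μ = -1}.ncard + 1 := by
  have hfin : {η | η ∈ ctx.Pos ∧ ctx.pairing η μ = -1}.Finite :=
    ctx.pos_finite.subset fun _ h => h.1
  rw [idealOf_eq hu hμ huθ hu0, Set.ncard_insert_of_notMem ?_ (hfin.image _),
    Set.InjOn.ncard_image]
  · intro η hη η' hη' h
    exact injOn_apply (inv_mem hu) (pos_mem hη.1) (pos_mem hη'.1) (add_right_cancel h)
  · rintro ⟨η, hη, h⟩
    exact ne_zero_of_mem (apply_emb_mem (inv_mem hu) (pos_mem hη.1)).2 (add_eq_right.1 h)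

end Count

end RootSystemCtx

/-- Theorem `unique`: properties of `w̃_μ = w_μ·s₀`: its
rootlet is `μ`, it is minuscule, all roots of its ideal are non-orthogonal to
`θ`, its ideal is the minimal element of `Ab_μ`, of cardinality
`(ρ, θ∨ − μ∨) + 1`. -/
theorem statement_15 {V : Type*} [AddCommGroup V] [Module ℚ V] (ctx : RootSystemCtx V)
    (μ : V) (hμ : μ ∈ ctx.PosLong)
    (wμ : (V × ℚ × ℚ) ≃ₗ[ℚ] (V × ℚ × ℚ)) (hwμ : wμ ∈ ctx.Wfin)
    (hwθ : wμ (ctx.emb ctx.θ) = ctx.emb μ)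
    (hminlen : ∀ u ∈ ctx.Wfin, u (ctx.emb ctx.θ) = ctx.emb μ →
      ctx.lenFin wμ ≤ ctx.lenFin u) :
    (wμ * ctx.refl ctx.alpha0) ctx.alpha0 + ctx.δhat = ctx.emb μ ∧
    ctx.IsMinuscule (wμ * ctx.refl ctx.alpha0) ∧
    (∀ γ ∈ ctx.idealOf (wμ * ctx.refl ctx.alpha0), 0 < ctx.B γ ctx.θ) ∧
    (∀ I ∈ ctx.AbFiber μ, ctx.idealOf (wμ * ctx.refl ctx.alpha0) ⊆ I) ∧
    ((ctx.idealOf (wμ * ctx.refl ctx.alpha0)).ncard : ℚ)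
      = ctx.B ctx.ρ (ctx.coroot ctx.θ - ctx.coroot μ) + 1 := by
  have hWmem : wμ ∈ ctx.What := RootSystemCtx.Wfin_le_What hwμ
  have hpos : ∀ α ∈ ctx.Pos, ctx.B α ctx.θ = 0 → wμ (ctx.emb α) ∈ ctx.PosHat :=
    fun α hα h0 => RootSystemCtx.apply_emb_mem_posHat hwμ hwθ hminlen hα h0
  refine ⟨?_, ⟨mul_mem hWmem (RootSystemCtx.refl_mem_What (RootSystemCtx.alpha0_mem_Δhat ctx)),
    fun b hb => ?_⟩, ?_, ?_, ?_⟩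
  · rw [RootSystemCtx.mul_refl_alpha0_apply hwμ hwθ, sub_add_cancel]
  · obtain ⟨γ, hγ, _, he⟩ :=
      RootSystemCtx.eq_δhat_sub_emb_of_mem_Nhat hwμ hμ.1 hwθ hpos hb
    exact ⟨γ, hγ, he⟩
  · rintro γ ⟨hγ, hb⟩
    obtain ⟨γ', _, hp, he⟩ :=
      RootSystemCtx.eq_δhat_sub_emb_of_mem_Nhat hwμ hμ.1 hwθ hpos hb
    rw [← RootSystemCtx.emb_injective (sub_right_inj.1 he)] at hp
    have h1 := RootSystemCtx.pairing_mul γ ctx.θ_mem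
    have h2 := mul_pos hp (RootSystemCtx.B_self_pos ctx.θ_mem)
    linarith
  · rintro I ⟨_, w, hw, rfl, hwα⟩
    exact RootSystemCtx.idealOf_subset hwμ hμ.1 hwθ hpos hw hwα
  · rw [RootSystemCtx.ncard_idealOf hwμ hμ.1 hwθ hpos,
      RootSystemCtx.B_ρ_coroot_sub hμ hwμ hwθ]
    push_cast
    rfl
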